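/- Let n ≥ 1 and p ≥ 1 be integers and a ≥ 1 a real constant with 2p < n+2a, and let 1 < α < (n+2a+2p)/(n+2a−2p). If u ∈ C^{2p}(closure of ℝ^{n+1}_+) is nonnegative and satisfies (−A)^p u = u^α in ℝ^{n+1}_+ = ℝ^n × (0,∞), then u ≡ 0. -/

import Mathlib

open MeasureTheory Metric Filter Function Topology

/-- Directional derivative of a function on `ℝⁿ × ℝ` along the vector `v`. -/
noncomputable def pdirP (n : ℕ) (v : EuclideanSpace ℝ (Fin n) × ℝ)
    (f : EuclideanSpace ℝ (Fin n) × ℝ → ℝ) (z : EuclideanSpace ℝ (Fin n) × ℝ) : ℝ :=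
  fderiv ℝ f z v

/-- The degenerate elliptic operator `A u = y ∂²u/∂y² + Δ_x u + a ∂u/∂y` acting on functions
of `(x, y) ∈ ℝⁿ × ℝ`. -/
noncomputable def opA (n : ℕ) (a : ℝ) (f : EuclideanSpace ℝ (Fin n) × ℝ → ℝ)
    (z : EuclideanSpace ℝ (Fin n) × ℝ) : ℝ :=
  z.2 * pdirP n (0, 1) (pdirP n (0, 1) f) z +
    (∑ i : Fin n,
      pdirP n (EuclideanSpace.single i 1, 0) (pdirP n (EuclideanSpace.single i 1, 0) f) z) +
    a * pdirP n (0, 1) f z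

/-- `(−A)^p`. -/
noncomputable def negAIter (n : ℕ) (a : ℝ) (p : ℕ)
    (f : EuclideanSpace ℝ (Fin n) × ℝ → ℝ) : EuclideanSpace ℝ (Fin n) × ℝ → ℝ :=
  (fun g z => -opA n a g z)^[p] f

/-- lifted space -/
abbrev LS (n : ℕ) := EuclideanSpace ℝ (Fin n ⊕ Fin 2)

/-- last coordinate -/
def lq {n : ℕ} (W : LS n) : ℝ := W (Sum.inr 1)

lemma lq_cont {n : ℕ} : Continuous (lq (n := n)) := by
  unfold lq; fun_prop

/-- density -/
noncomputable def wt {n : ℕ} (b : ℝ) (W : LS n) : ℝ := |lq W| ^ b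

lemma wt_nonneg {n : ℕ} (b : ℝ) (W : LS n) : 0 ≤ wt b W := Real.rpow_nonneg (abs_nonneg _) _

lemma wt_cont {n : ℕ} {b : ℝ} (hb : 0 ≤ b) : Continuous (wt (n := n) b) := by
  unfold wt
  exact (lq_cont.abs).rpow_const (fun _ => Or.inr hb)

/-- weighted measure -/
noncomputable def mw (n : ℕ) (b : ℝ) : Measure (LS n) :=
  (volume : Measure (LS n)).withDensity (fun W => ENNReal.ofReal (wt b W))

lemma mw_locfin (n : ℕ) {b : ℝ} (hb : 0 ≤ b) : IsLocallyFiniteMeasure (mw n b) :=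
  IsLocallyFiniteMeasure.withDensity_ofReal (wt_cont hb)

lemma mw_ac (n : ℕ) (b : ℝ) : mw n b ≪ volume := withDensity_absolutelyContinuous _ _

lemma integral_mw {n : ℕ} {b : ℝ} (hb : 0 ≤ b) (g : LS n → ℝ) :
    ∫ W, g W ∂(mw n b) = ∫ W, wt b W * g W := by
  unfold mw
  rw [integral_withDensity_eq_integral_toReal_smul]
  · simp only [smul_eq_mul]
    congr 1; ext W; rw [ENNReal.toReal_ofReal (wt_nonneg _ _)]
  · exact (wt_cont hb).measurable.ennreal_ofReal
  · exact Eventually.of_forall fun _ => ENNReal.ofReal_lt_top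

/-- change of variables -/
lemma mw_change {n : ℕ} {b : ℝ} (hb : 0 ≤ b) {s : Set (LS n)} (hs : MeasurableSet s)
    {f : LS n → LS n} {f' : LS n → LS n →L[ℝ] LS n}
    (hf' : ∀ x ∈ s, HasFDerivWithinAt f (f' x) s x) (hf : Set.InjOn f s)
    (him : MeasurableSet (f '' s))
    (ρ : LS n → ℝ) (hρ : ∀ x ∈ s, 0 ≤ ρ x) (hq : ∀ x ∈ s, |lq (f x)| = ρ x * |lq x|)
    (g : LS n → ENNReal) :
    ∫⁻ x in f '' s, g x ∂(mw n b) =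
      ∫⁻ x in s, ENNReal.ofReal (|(f' x).det| * ρ x ^ b) * g (f x) ∂(mw n b) := by
  unfold mw
  have hm : Measurable (fun W : LS n => ENNReal.ofReal (wt b W)) :=
    (wt_cont hb).measurable.ennreal_ofReal
  rw [setLIntegral_withDensity_eq_setLIntegral_mul_non_measurable _ hm _ him
    (Eventually.of_forall fun _ => ENNReal.ofReal_lt_top),
    setLIntegral_withDensity_eq_setLIntegral_mul_non_measurable _ hm _ hs
    (Eventually.of_forall fun _ => ENNReal.ofReal_lt_top),
    lintegral_image_eq_lintegral_abs_det_fderiv_mul _ hs hf' hf]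
  refine setLIntegral_congr_fun hs fun x hx => ?_
  simp only [Pi.mul_apply]
  have : wt b (f x) = ρ x ^ b * wt b x := by
    unfold wt; rw [hq x hx, Real.mul_rpow (hρ x hx) (abs_nonneg _)]
  rw [this, ENNReal.ofReal_mul (abs_nonneg _), ENNReal.ofReal_mul (Real.rpow_nonneg (hρ x hx) _)]
  ring

lemma mw_translate {n : ℕ} {b : ℝ} (hb : 0 ≤ b) {X : LS n} (hX : lq X = 0) :
    MeasurePreserving (fun W => W + X) (mw n b) (mw n b) := by
  refine ⟨by fun_prop, ?_⟩
  ext s hs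
  rw [Measure.map_apply (by fun_prop) hs]
  have h := mw_change (n := n) hb MeasurableSet.univ (f := fun W => W + X)
    (f' := fun _ => ContinuousLinearMap.id ℝ _)
    (fun x _ => ((hasFDerivAt_id x).add_const X).hasFDerivWithinAt)
    ((add_left_injective X).injOn) (by rw [Set.image_univ, (add_right_surjective X).range_eq]; exact .univ)
    (fun _ => 1) (fun _ _ => zero_le_one) (fun x _ => by unfold lq at *; simp [hX])
    (s.indicator 1)
  rw [Set.image_univ, (add_right_surjective X).range_eq] at h
  have hdet : (ContinuousLinearMap.id ℝ (LS n)).det = 1 := by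
    simp [ContinuousLinearMap.det]
  simp only [hdet, Measure.restrict_univ] at h
  rw [lintegral_indicator_one hs] at h
  rw [h, ← lintegral_indicator_one ((by fun_prop : Measurable (fun W : LS n => W + X)) hs)]
  congr 1; ext W; simp [Set.indicator]; rfl

lemma det_smul_clm {n : ℕ} (r : ℝ) (f : LS n →L[ℝ] LS n) :
    (r • f).det = r ^ (n + 2) * f.det := by
  simp [ContinuousLinearMap.det, LinearMap.det_smul]

lemma mw_scale {n : ℕ} {b : ℝ} (hb : 0 ≤ b) {R : ℝ} (hR : 0 < R) :
    mw n b = ENNReal.ofReal (R ^ ((n : ℝ) + 2 + b)) • Measure.map (fun W => R • W) (mw n b) := by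
  ext s hs
  rw [Measure.smul_apply, Measure.map_apply (by fun_prop) hs]
  have hsurj : Function.Surjective (fun W : LS n => R • W) :=
    fun W => ⟨R⁻¹ • W, by simp [smul_smul, hR.ne']⟩
  have h := mw_change (n := n) hb MeasurableSet.univ (f := fun W => R • W)
    (f' := fun _ => R • ContinuousLinearMap.id ℝ _)
    (fun x _ => ((hasFDerivAt_id x).const_smul R).hasFDerivWithinAt)
    ((smul_right_injective (LS n) hR.ne').injOn) (by rw [Set.image_univ, hsurj.range_eq]; exact .univ)
    (fun _ => R) (fun _ _ => hR.le) (fun x _ => by unfold lq at *; simp [abs_mul, abs_of_pos hR])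
    (s.indicator 1)
  rw [Set.image_univ, hsurj.range_eq] at h
  have hdet : (ContinuousLinearMap.id ℝ (LS n)).det = 1 := by
    simp [ContinuousLinearMap.det]
  simp only [det_smul_clm, hdet, Measure.restrict_univ] at h
  rw [lintegral_indicator_one hs] at h
  rw [h, lintegral_const_mul' _ _ ENNReal.ofReal_ne_top,
    ← lintegral_indicator_one ((by fun_prop : Measurable (fun W : LS n => R • W)) hs)]
  have : |R ^ (n + 2) * 1| * R ^ b = R ^ ((n : ℝ) + 2 + b) := by
    rw [mul_one, abs_of_pos (by positivity), Real.rpow_add hR]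
    congr 1
    rw [← Real.rpow_natCast]; push_cast; rfl
  rw [this]; rfl

lemma integral_scale {n : ℕ} {b : ℝ} (hb : 0 ≤ b) {R : ℝ} (hR : 0 < R) (f : LS n → ℝ) :
    ∫ W, f W ∂(mw n b) = R ^ ((n : ℝ) + 2 + b) * ∫ W, f (R • W) ∂(mw n b) := by
  conv_lhs => rw [mw_scale hb hR]
  rw [integral_smul_measure, ENNReal.toReal_ofReal (by positivity)]
  congr 1
  exact (MeasurableEquiv.smul₀ R hR.ne').measurableEmbedding.integral_map f

lemma integral_translate {n : ℕ} {b : ℝ} (hb : 0 ≤ b) {X : LS n} (hX : lq X = 0) (f : LS n → ℝ) :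
    ∫ W, f W ∂(mw n b) = ∫ W, f (W + X) ∂(mw n b) :=
  ((mw_translate hb hX).integral_comp (MeasurableEquiv.addRight X).measurableEmbedding f).symm

/-- Kelvin inversion -/
noncomputable def kel {n : ℕ} (l : ℝ) (W : LS n) : LS n := (l / ‖W‖) ^ 2 • W

lemma kel_eq {n : ℕ} (l : ℝ) (W : LS n) : kel l W = EuclideanGeometry.inversion 0 l W := by
  simp [kel, EuclideanGeometry.inversion]

lemma kel_kel {n : ℕ} {l : ℝ} (hl : l ≠ 0) (W : LS n) : kel l (kel l W) = W := by
  rw [kel_eq, kel_eq, EuclideanGeometry.inversion_inversion _ hl]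

lemma norm_kel {n : ℕ} (l : ℝ) (W : LS n) : ‖kel l W‖ = l ^ 2 / ‖W‖ := by
  have := EuclideanGeometry.dist_inversion_center (0 : LS n) W l
  rwa [← kel_eq, dist_zero_right, dist_zero_right] at this

lemma kel_dist {n : ℕ} {l : ℝ} {W Z : LS n} (hW : W ≠ 0) (hZ : Z ≠ 0) :
    ‖kel l W - kel l Z‖ = l ^ 2 / (‖W‖ * ‖Z‖) * ‖W - Z‖ := by
  have := EuclideanGeometry.dist_inversion_inversion hW hZ l
  rwa [← kel_eq, ← kel_eq, dist_zero_right, dist_zero_right, dist_eq_norm, dist_eq_norm] at this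

lemma lq_kel {n : ℕ} (l : ℝ) (W : LS n) : lq (kel l W) = (l / ‖W‖) ^ 2 * lq W := by
  simp [lq, kel]

lemma kel_image {n : ℕ} {l : ℝ} (hl : 0 < l) :
    kel l '' (ball (0 : LS n) l \ {0}) = {W : LS n | l < ‖W‖} := by
  ext W
  simp only [Set.mem_image, Set.mem_sdiff, mem_ball, dist_zero_right, Set.mem_singleton_iff,
    Set.mem_ofPred_eq]
  constructor
  · rintro ⟨Z, ⟨h1, h2⟩, rfl⟩
    rw [norm_kel, lt_div_iff₀ (norm_pos_iff.2 h2)]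
    nlinarith
  · intro h
    refine ⟨kel l W, ⟨?_, ?_⟩, kel_kel hl.ne' W⟩
    · rw [norm_kel, div_lt_iff₀ (hl.trans h)]; nlinarith
    · rw [← ne_eq, ← norm_ne_zero_iff, norm_kel]
      have : 0 < ‖W‖ := hl.trans h
      positivity

lemma mw_kel {n : ℕ} {b : ℝ} (hb : 0 ≤ b) {l : ℝ} (hl : 0 < l) (g : LS n → ENNReal) :
    ∫⁻ W in {W : LS n | l < ‖W‖}, g W ∂(mw n b) =
      ∫⁻ W in ball (0 : LS n) l \ {0},
        ENNReal.ofReal ((l / ‖W‖) ^ (2 * ((n : ℝ) + 2 + b))) * g (kel l W) ∂(mw n b) := by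
  have hms : MeasurableSet (ball (0 : LS n) l \ {0}) :=
    measurableSet_ball.diff (measurableSet_singleton _)
  have him : MeasurableSet (kel l '' (ball (0 : LS n) l \ {0})) := by
    rw [kel_image hl]
    exact (isOpen_lt continuous_const continuous_norm).measurableSet
  have h := mw_change (n := n) hb hms (f := kel l)
    (f' := fun x => (l / dist x 0) ^ 2 • ((ℝ ∙ (x - 0))ᗮ.reflection : LS n →L[ℝ] LS n))
    (fun x hx => by
      have : kel (n := n) l = EuclideanGeometry.inversion 0 l := by
        ext1 W; exact kel_eq l W
      rw [this]
      exact (EuclideanGeometry.hasFDerivAt_inversion hx.2).hasFDerivWithinAt)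
    (by
      intro x _ y _ hxy
      have := congrArg (kel l) hxy
      rwa [kel_kel hl.ne', kel_kel hl.ne'] at this) him
    (fun W => (l / ‖W‖) ^ 2) (fun _ _ => by positivity)
    (fun x _ => by rw [lq_kel, abs_mul, abs_of_nonneg (by positivity : 0 ≤ (l / ‖x‖) ^ 2)]) g
  rw [kel_image hl] at h
  rw [h]
  refine setLIntegral_congr_fun hms fun x hx => ?_
  have hx0 : 0 < ‖x‖ := norm_pos_iff.2 hx.2
  congr 2
  rw [det_smul_clm]
  have hr : |((((ℝ ∙ (x - 0))ᗮ.reflection : LS n ≃L[ℝ] LS n) : LS n →L[ℝ] LS n)).det| = 1 := by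
    have := (ℝ ∙ (x - 0))ᗮ.det_reflection
    have h2 : (((((ℝ ∙ (x - 0))ᗮ.reflection : LS n ≃L[ℝ] LS n) : LS n →L[ℝ] LS n)).det) =
      LinearMap.det ((ℝ ∙ (x - 0))ᗮ.reflection.toLinearMap) := rfl
    rw [h2, this]; simp
  have hp : 0 < l / ‖x‖ := by positivity
  rw [abs_mul, dist_zero_right]
  erw [hr]
  rw [mul_one, abs_of_nonneg (by positivity), mul_add, Real.rpow_add hp, ← Real.rpow_natCast (l / ‖x‖) 2,
    ← Real.rpow_natCast, ← Real.rpow_mul hp.le, ← Real.rpow_mul hp.le]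
  push_cast
  rfl

lemma wt_pos_ae (n : ℕ) (b : ℝ) : ∀ᵐ W : LS n, 0 < wt b W := by
  let A : Submodule ℝ (LS n) := LinearMap.ker
    (EuclideanSpace.proj (𝕜 := ℝ) (Sum.inr 1 : Fin n ⊕ Fin 2)).toLinearMap
  have hA : volume (A : Set (LS n)) = 0 := by
    apply Measure.addHaar_submodule
    intro h
    have : (EuclideanSpace.single (Sum.inr 1 : Fin n ⊕ Fin 2) (1 : ℝ)) ∈ A := by rw [h]; trivial
    simp [A] at this
  rw [ae_iff]
  refine measure_mono_null ?_ hA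
  intro W hW
  simp only [Set.mem_ofPred_eq, not_lt] at hW
  by_contra hne
  have : lq W ≠ 0 := fun h0 => hne (by simpa [A, lq] using h0)
  exact absurd (Real.rpow_pos_of_pos (abs_pos.2 this) b) (not_lt.2 hW)

lemma mw_vol_ac (n : ℕ) {b : ℝ} (hb : 0 ≤ b) : volume ≪ mw n b := by
  apply withDensity_absolutelyContinuous' (wt_cont hb).measurable.ennreal_ofReal.aemeasurable
  filter_upwards [wt_pos_ae n b] with W hW
  simpa using hW

lemma mw_open_pos (n : ℕ) {b : ℝ} (hb : 0 ≤ b) {U : Set (LS n)} (hU : IsOpen U)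
    (hne : U.Nonempty) : 0 < mw n b U := by
  rw [pos_iff_ne_zero]
  intro h
  exact (hU.measure_pos volume hne).ne' (mw_vol_ac n hb h)

lemma mw_singleton (n : ℕ) (b : ℝ) (X : LS n) : mw n b {X} = 0 :=
  mw_ac n b (measure_singleton X)

lemma mw_sphere (n : ℕ) (b : ℝ) (X : LS n) (r : ℝ) : mw n b (sphere X r) = 0 :=
  mw_ac n b (Measure.addHaar_sphere volume X r)

lemma mw_ball_lt_top (n : ℕ) {b : ℝ} (hb : 0 ≤ b) (X : LS n) (r : ℝ) : mw n b (ball X r) < ⊤ := by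
  have := mw_locfin n hb
  exact (measure_mono ball_subset_closedBall).trans_lt (isCompact_closedBall X r).measure_lt_top

lemma integrable_of_cont_compact {n : ℕ} {b : ℝ} (hb : 0 ≤ b) {f : LS n → ℝ} (hf : Continuous f)
    (hc : HasCompactSupport f) : Integrable f (mw n b) := by
  have := mw_locfin n hb
  exact hf.integrable_of_hasCompactSupport hc

/-- basis vectors -/
noncomputable abbrev eb {n : ℕ} (i : Fin n ⊕ Fin 2) : LS n := EuclideanSpace.single i 1

lemma integral_lineDeriv_zero {n : ℕ} {F F' : LS n → ℝ} {K : Set (LS n)} (hK : IsCompact K)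
    (hF : Continuous F) (hF' : Continuous F') (h0 : ∀ W ∉ K, F W = 0) (h0' : ∀ W ∉ K, F' W = 0)
    {e : LS n} (hd : ∀ W, HasLineDerivAt ℝ F (F' W) W e) : ∫ W, F' W = 0 := by
  have i1 : Integrable F := hF.integrable_of_hasCompactSupport (HasCompactSupport.intro hK h0)
  have i2 : Integrable F' := hF'.integrable_of_hasCompactSupport (HasCompactSupport.intro hK h0')
  have := integral_bilinear_hasLineDerivAt_right_eq_neg_left_of_integrable (μ := volume)
    (f := fun _ : LS n => (1 : ℝ)) (f' := fun _ => 0) (g := F) (g' := F') (v := e)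
    (B := ContinuousLinearMap.mul ℝ ℝ) (by simp) (by simpa using i2) (by simpa using i1)
    (fun x _ => by
      unfold HasLineDerivAt
      exact hasDerivAt_const _ _)
    (fun x _ => hd x)
  simpa using this

/-- second order data of a function on the lifted space -/
structure LapData (n : ℕ) where
  f : LS n → ℝ
  f1 : Fin n ⊕ Fin 2 → LS n → ℝ
  f2 : Fin n ⊕ Fin 2 → LS n → ℝ
  h : LS n → ℝ
  h' : LS n → ℝ
  cf : Continuous f
  cf1 : ∀ i, Continuous (f1 i)
  cf2 : ∀ i, Continuous (f2 i)
  ch : Continuous h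
  ch' : Continuous h'
  df : ∀ i W, HasLineDerivAt ℝ f (f1 i W) W (eb i)
  df1 : ∀ i W, HasLineDerivAt ℝ (f1 i) (f2 i W) W (eb i)
  dh : ∀ W, HasLineDerivAt ℝ h (h' W) W (eb (Sum.inr 1))
  e1 : ∀ W, f1 (Sum.inr 1) W = lq W * h W
  e2 : ∀ W, f2 (Sum.inr 1) W = h W + lq W * h' W

/-- the lifted operator -/
def LapData.op {n : ℕ} (D : LapData n) (b : ℝ) (W : LS n) : ℝ := (∑ i, D.f2 i W) + b * D.h W

lemma hasDerivAt_abs_rpow_mul {b : ℝ} (hb : 0 ≤ b) (q : ℝ) :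
    HasDerivAt (fun q : ℝ => |q| ^ b * q) ((b + 1) * |q| ^ b) q := by
  have hc : Continuous (fun q : ℝ => |q| ^ b) :=
    continuous_abs.rpow_const (fun _ => Or.inr hb)
  have key : ∀ y : ℝ, y ≠ 0 → HasDerivAt (fun q : ℝ => |q| ^ b * q) ((b + 1) * |y| ^ b) y := by
    intro y hy
    have h1 := ((hasDerivAt_abs hy).rpow_const (p := b) (Or.inl (abs_ne_zero.2 hy))).mul
      (hasDerivAt_id y)
    refine h1.congr_deriv ?_
    have h2 : |y| ^ b = |y| ^ (b - 1) * |y| := by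
      rw [← Real.rpow_add_one (abs_ne_zero.2 hy)]; simp
    have h3 : (SignType.sign y : ℝ) * y = |y| := sign_mul_self y
    simp only [id]
    rw [h2]
    linear_combination (b * |y| ^ (b - 1)) * h3
  rcases eq_or_ne q 0 with rfl | hq
  · exact hasDerivAt_of_hasDerivAt_of_ne (g := fun y => (b + 1) * |y| ^ b) (fun y hy => key y hy)
      (hc.mul continuous_id).continuousAt (continuous_const.mul hc).continuousAt
  · exact key q hq

lemma hasLineDerivAt_lq {n : ℕ} {i : Fin n ⊕ Fin 2} (hi : i ≠ Sum.inr 1) (W : LS n) (t : ℝ) :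
    lq (W + t • eb i) = lq W := by
  simp [lq, hi.symm]

lemma lq_line {n : ℕ} (W : LS n) (t : ℝ) :
    lq (W + t • eb (Sum.inr 1)) = lq W + t := by
  simp [lq]

lemma green {n : ℕ} {b : ℝ} (hb : 0 ≤ b) (D G : LapData n) {K : Set (LS n)} (hK : IsCompact K)
    (g0 : ∀ W ∉ K, G.f W = 0) (g1 : ∀ i, ∀ W ∉ K, G.f1 i W = 0)
    (g2 : ∀ i, ∀ W ∉ K, G.f2 i W = 0) (gh : ∀ W ∉ K, G.h W = 0) :
    ∫ W, D.op b W * G.f W ∂(mw n b) = ∫ W, D.f W * G.op b W ∂(mw n b) := by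
  rw [integral_mw hb, integral_mw hb, ← sub_eq_zero]
  have cw := wt_cont (n := n) hb
  have := D.cf; have := D.cf1; have := D.cf2; have := D.ch; have := D.ch'
  have := G.cf; have := G.cf1; have := G.cf2; have := G.ch; have := G.ch'
  have gop : ∀ W ∉ K, G.op b W = 0 := by
    intro W hW; simp [LapData.op, g2 _ W hW, gh W hW]
  have cop : ∀ D : LapData n, Continuous (D.op b) := by
    intro D
    unfold LapData.op
    have := D.cf2; have := D.ch
    fun_prop
  have cD := cop D
  have cG := cop G
  have I1 : Integrable (fun W => wt b W * (D.op b W * G.f W)) :=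
    Continuous.integrable_of_hasCompactSupport (by fun_prop)
      (HasCompactSupport.intro hK fun W hW => by simp [g0 W hW])
  have I2 : Integrable (fun W => wt b W * (D.f W * G.op b W)) :=
    Continuous.integrable_of_hasCompactSupport (by fun_prop)
      (HasCompactSupport.intro hK fun W hW => by simp [gop W hW])
  rw [← integral_sub I1 I2]
  let T : Fin n ⊕ Fin 2 → LS n → ℝ := fun i W =>
    if i = Sum.inr 1 then wt b W * ((D.f2 i W + b * D.h W) * G.f W - D.f W * (G.f2 i W + b * G.h W))
    else wt b W * (D.f2 i W * G.f W - D.f W * G.f2 i W)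
  have hT : ∀ W, wt b W * (D.op b W * G.f W) - wt b W * (D.f W * G.op b W) = ∑ i, T i W := by
    intro W
    simp only [T, LapData.op, Fintype.sum_sum_type, Fin.sum_univ_two]
    simp only [reduceCtorEq, if_false, Sum.inr.injEq, zero_ne_one, if_true]
    rw [← Finset.mul_sum, Finset.sum_sub_distrib, ← Finset.sum_mul, ← Finset.mul_sum]
    ring
  have cT : ∀ i, Continuous (T i) := by
    intro i
    by_cases hi : i = Sum.inr 1
    · simp only [T, hi, if_true]; fun_prop
    · simp only [T, hi, if_false]; fun_prop
  have vT : ∀ i, ∀ W ∉ K, T i W = 0 := by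
    intro i W hW
    by_cases hi : i = Sum.inr 1
    · simp [T, hi, g0 W hW, g2 _ W hW, gh W hW]
    · simp [T, hi, g0 W hW, g2 _ W hW]
  have zT : ∀ i, ∫ W, T i W = 0 := by
    intro i
    refine integral_lineDeriv_zero hK (F := fun W => wt b W * (D.f1 i W * G.f W - D.f W * G.f1 i W))
      (e := eb i) (by fun_prop) (cT i) (fun W hW => by simp [g0 W hW, g1 i W hW]) (vT i) ?_
    intro W
    by_cases hi : i = Sum.inr 1
    · subst hi
      have hF : (fun W => wt b W * (D.f1 (Sum.inr 1) W * G.f W - D.f W * G.f1 (Sum.inr 1) W)) =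
          fun W => (wt b W * lq W) * (D.h W * G.f W - D.f W * G.h W) := by
        ext W; rw [D.e1, G.e1]; ring
      rw [hF]
      have k1 := D.dh W
      have k2 := G.dh W
      have k3 := D.df (Sum.inr 1) W
      have k4 := G.df (Sum.inr 1) W
      unfold HasLineDerivAt at *
      have k5 : HasDerivAt (fun t : ℝ => wt b (W + t • eb (Sum.inr 1)) * lq (W + t • eb (Sum.inr 1)))
          ((b + 1) * wt b W) 0 := by
        simp only [wt, lq_line]
        have h := hasDerivAt_abs_rpow_mul hb (lq W)
        have h' : HasDerivAt (fun t : ℝ => lq W + t) 1 0 := (hasDerivAt_id 0).const_add _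
        have := HasDerivAt.comp (h₂ := fun q : ℝ => |q| ^ b * q) (0 : ℝ) (by simpa using h) h'
        simpa [Function.comp_def] using this
      refine (k5.mul ((k1.mul k4).sub (k3.mul k2))).congr_deriv ?_
      simp only [zero_smul, add_zero, T, if_true, D.e1, G.e1, D.e2, G.e2, Pi.mul_apply, Pi.sub_apply]
      ring
    · have k1 := D.df1 i W
      have k2 := G.df1 i W
      have k3 := D.df i W
      have k4 := G.df i W
      unfold HasLineDerivAt at *
      have k5 : HasDerivAt (fun t : ℝ => wt b (W + t • eb i)) 0 0 := by
        simp only [wt, hasLineDerivAt_lq hi]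
        exact hasDerivAt_const _ _
      refine (k5.mul ((k1.mul k4).sub (k3.mul k2))).congr_deriv ?_
      simp only [zero_smul, add_zero, T, hi, if_false, Pi.mul_apply, Pi.sub_apply]
      ring
  simp_rw [hT]
  rw [integral_finsetSum]
  · simp [zT]
  · intro i _
    exact (cT i).integrable_of_hasCompactSupport (HasCompactSupport.intro hK (vT i))

open Polynomial in
lemma poly_max_deriv {P : ℝ[X]} (hP : X ^ 2 ∣ P) (s : ℝ) :
    HasDerivAt (fun s : ℝ => P.eval (max s 0)) ((derivative P).eval (max s 0)) s := by
  obtain ⟨Q, rfl⟩ := hP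
  have cont : ∀ P : ℝ[X], Continuous fun s : ℝ => P.eval (max s 0) := fun P =>
    P.continuous.comp (continuous_id.max continuous_const)
  have key : ∀ y : ℝ, y ≠ 0 → HasDerivAt (fun s : ℝ => (X ^ 2 * Q).eval (max s 0))
      ((derivative (X ^ 2 * Q)).eval (max y 0)) y := by
    intro y hy
    rcases lt_or_gt_of_ne hy with h | h
    · rw [max_eq_right h.le]
      have : (derivative (X ^ 2 * Q)).eval 0 = 0 := by simp [derivative_mul]
      rw [this]
      refine (hasDerivAt_const y (0 : ℝ)).congr_of_eventuallyEq ?_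
      filter_upwards [Iio_mem_nhds h] with z hz
      rw [max_eq_right (le_of_lt hz)]; simp
    · rw [max_eq_left h.le]
      refine ((X ^ 2 * Q).hasDerivAt y).congr_of_eventuallyEq ?_
      filter_upwards [Ioi_mem_nhds h] with z hz
      rw [max_eq_left (le_of_lt hz)]
  rcases eq_or_ne s 0 with rfl | hs
  · exact hasDerivAt_of_hasDerivAt_of_ne (g := fun y => (derivative (X ^ 2 * Q)).eval (max y 0))
      (fun y hy => key y hy) (cont _).continuousAt (cont _).continuousAt
  · exact key s hs

/-- the radial truncation -/
noncomputable def tt {n : ℕ} (X : LS n) (R : ℝ) (W : LS n) : ℝ := max (1 - ‖W - X‖ ^ 2 / R ^ 2) 0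

lemma tt_cont {n : ℕ} (X : LS n) (R : ℝ) : Continuous (tt X R) := by unfold tt; fun_prop

lemma tt_nonneg {n : ℕ} (X : LS n) (R : ℝ) (W : LS n) : 0 ≤ tt X R W := le_max_right _ _

lemma tt_le_one {n : ℕ} (X : LS n) (R : ℝ) (W : LS n) : tt X R W ≤ 1 := by
  refine max_le ?_ zero_le_one
  have : 0 ≤ ‖W - X‖ ^ 2 / R ^ 2 := by positivity
  linarith

lemma tt_zero {n : ℕ} {X : LS n} {R : ℝ} (hR : 0 < R) {W : LS n} (h : W ∉ ball X R) :
    tt X R W = 0 := by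
  rw [mem_ball, dist_eq_norm, not_lt] at h
  refine max_eq_right ?_
  rw [sub_nonpos, one_le_div (by positivity)]
  gcongr

open Polynomial in
/-- radial operator on polynomials -/
noncomputable def LP (N : ℝ) (P : ℝ[X]) : ℝ[X] :=
  4 * (1 - X) * derivative (derivative P) - C (2 * N) * derivative P

open Polynomial in
lemma dvd_deriv {P : ℝ[X]} {k : ℕ} (h : X ^ (k + 1) ∣ P) : X ^ k ∣ derivative P := by
  obtain ⟨Q, rfl⟩ := h
  rw [derivative_mul, derivative_X_pow]
  refine dvd_add ?_ ?_
  · simp only [Nat.add_sub_cancel]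
    exact Dvd.dvd.mul_right (Dvd.dvd.mul_left dvd_rfl _) _
  · rw [pow_succ, mul_assoc]; exact Dvd.intro _ rfl

open Polynomial in
lemma dvd_LP {N : ℝ} {P : ℝ[X]} {k : ℕ} (h : X ^ (k + 2) ∣ P) : X ^ k ∣ LP N P := by
  unfold LP
  have h1 := dvd_deriv h
  exact dvd_sub (Dvd.dvd.mul_left (dvd_deriv h1) _)
    (Dvd.dvd.mul_left ((pow_dvd_pow _ (Nat.le_succ _)).trans h1) _)

lemma norm_sq_line {n : ℕ} (X W : LS n) (i : Fin n ⊕ Fin 2) (R : ℝ) :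
    HasDerivAt (fun t : ℝ => 1 - ‖(W + t • eb i) - X‖ ^ 2 / R ^ 2) (-(2 / R ^ 2 * (W i - X i))) 0 := by
  have h : ∀ t : ℝ, ‖(W + t • eb i) - X‖ ^ 2 = ‖W - X‖ ^ 2 + 2 * t * (W i - X i) + t ^ 2 := by
    intro t
    have : W + t • eb i - X = (W - X) + t • eb i := by abel
    rw [this, norm_add_sq_real, inner_smul_right, EuclideanSpace.inner_single_right, norm_smul]
    simp
    ring
  simp_rw [h]
  have h1 : HasDerivAt (fun t : ℝ => ‖W - X‖ ^ 2 + 2 * t * (W i - X i) + t ^ 2)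
      (2 * (W i - X i)) 0 := by
    have := (((hasDerivAt_id (0 : ℝ)).const_mul 2).mul_const (W i - X i)).const_add (‖W - X‖ ^ 2)
    have := this.add (hasDerivAt_pow 2 (0 : ℝ))
    refine this.congr_deriv (by simp)
  refine ((h1.div_const (R ^ 2)).const_sub 1).congr_deriv ?_
  ring

open Polynomial in
lemma poly_tt_line {n : ℕ} {P : ℝ[X]} (hP : X ^ 2 ∣ P) (Z W : LS n) (R : ℝ) (i : Fin n ⊕ Fin 2) :
    HasLineDerivAt ℝ (fun W => P.eval (tt Z R W))
      (-(2 / R ^ 2 * (W i - Z i)) * (derivative P).eval (tt Z R W)) W (eb i) := by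
  unfold HasLineDerivAt tt
  have h := norm_sq_line Z W i R
  have h2 := poly_max_deriv hP (1 - ‖W - Z‖ ^ 2 / R ^ 2)
  have := HasDerivAt.comp (h₂ := fun s : ℝ => P.eval (max s 0)) (0 : ℝ) (by simpa using h2) h
  refine this.congr_deriv ?_
  ring

lemma coord_line {n : ℕ} (Z W : LS n) (i : Fin n ⊕ Fin 2) (c : ℝ) :
    HasLineDerivAt ℝ (fun W : LS n => -(c * (W i - Z i))) (-c) W (eb i) := by
  unfold HasLineDerivAt
  have : (fun t : ℝ => -(c * ((W + t • eb i) i - Z i))) = fun t => -(c * (W i - Z i)) + (-c) * t := by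
    ext t; simp; ring
  rw [this]
  simpa using ((hasDerivAt_id (0 : ℝ)).const_mul (-c)).const_add (-(c * (W i - Z i)))

open Polynomial in
/-- data of a radial test function -/
noncomputable def testData {n : ℕ} (Z : LS n) (hZ : lq Z = 0) (R : ℝ) (P : ℝ[X]) (hP : X ^ 3 ∣ P) :
    LapData n where
  f := fun W => P.eval (tt Z R W)
  f1 := fun i W => -(2 / R ^ 2 * (W i - Z i)) * (derivative P).eval (tt Z R W)
  f2 := fun i W => (-(2 / R ^ 2)) * (derivative P).eval (tt Z R W) +
    -(2 / R ^ 2 * (W i - Z i)) *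
      (-(2 / R ^ 2 * (W i - Z i)) * (derivative (derivative P)).eval (tt Z R W))
  h := fun W => (-(2 / R ^ 2)) * (derivative P).eval (tt Z R W)
  h' := fun W => (-(2 / R ^ 2)) * (-(2 / R ^ 2 * (W (Sum.inr 1) - Z (Sum.inr 1))) *
    (derivative (derivative P)).eval (tt Z R W))
  cf := P.continuous.comp (tt_cont Z R)
  cf1 := fun i => by
    have := (derivative P).continuous.comp (tt_cont Z R)
    simp only [Function.comp_def] at this
    fun_prop
  cf2 := fun i => by
    have := (derivative P).continuous.comp (tt_cont Z R)
    have := (derivative (derivative P)).continuous.comp (tt_cont Z R)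
    simp only [Function.comp_def] at *
    fun_prop
  ch := by
    have := (derivative P).continuous.comp (tt_cont Z R)
    simp only [Function.comp_def] at *
    fun_prop
  ch' := by
    have := (derivative (derivative P)).continuous.comp (tt_cont Z R)
    simp only [Function.comp_def] at *
    fun_prop
  df := fun i W => poly_tt_line ((pow_dvd_pow X (by norm_num)).trans hP) Z W R i
  df1 := fun i W => by
    have h1 := coord_line Z W i (2 / R ^ 2)
    have h2 := poly_tt_line (dvd_deriv hP) Z W R i
    unfold HasLineDerivAt at *
    have := h1.mul h2
    simp only [zero_smul, add_zero] at this
    exact this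
  dh := fun W => by
    have h2 := poly_tt_line (dvd_deriv hP) Z W R (Sum.inr 1)
    unfold HasLineDerivAt at *
    exact h2.const_mul _
  e1 := fun W => by
    unfold lq at *
    rw [hZ]; ring
  e2 := fun W => by
    unfold lq at *
    rw [hZ]; ring

open Polynomial in
lemma testData_op {n : ℕ} (Z : LS n) (hZ : lq Z = 0) {R : ℝ} (hR : 0 < R) (P : ℝ[X])
    (hP : X ^ 3 ∣ P) (b : ℝ) (W : LS n) :
    (testData Z hZ R P hP).op b W = (R ^ 2)⁻¹ * (LP ((n : ℝ) + 2 + b) P).eval (tt Z R W) := by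
  simp only [LapData.op, testData, Finset.sum_add_distrib, Finset.sum_const, Finset.card_univ,
    Fintype.card_sum, Fintype.card_fin, nsmul_eq_mul]
  have h1 : ∑ i, -(2 / R ^ 2 * (W i - Z i)) *
      (-(2 / R ^ 2 * (W i - Z i)) * (derivative (derivative P)).eval (tt Z R W)) =
      4 / R ^ 2 * (‖W - Z‖ ^ 2 / R ^ 2) * (derivative (derivative P)).eval (tt Z R W) := by
    rw [EuclideanSpace.norm_sq_eq, Finset.sum_div, Finset.mul_sum, Finset.sum_mul]
    refine Finset.sum_congr rfl fun i _ => ?_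
    simp only [PiLp.sub_apply, Real.norm_eq_abs, sq_abs]
    field_simp
    ring
  have h2 : (‖W - Z‖ ^ 2 / R ^ 2) * (derivative (derivative P)).eval (tt Z R W) =
      (1 - tt Z R W) * (derivative (derivative P)).eval (tt Z R W) := by
    rcases le_total (1 - ‖W - Z‖ ^ 2 / R ^ 2) 0 with h | h
    · have h0 : tt Z R W = 0 := max_eq_right h
      have h3 : X ^ 1 ∣ derivative (derivative P) := dvd_deriv (dvd_deriv hP)
      have : (derivative (derivative P)).eval 0 = 0 := by
        obtain ⟨Q, hQ⟩ := h3
        rw [hQ]; simp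
      rw [h0, this]; ring
    · have h0 : tt Z R W = 1 - ‖W - Z‖ ^ 2 / R ^ 2 := max_eq_left h
      congr 1
      rw [h0]; ring
  rw [h1, mul_assoc, h2]
  simp only [LP, eval_sub, eval_mul, eval_one, eval_X, eval_C, eval_ofNat]
  push_cast
  field_simp
  ring

open Polynomial in
lemma green_test {n : ℕ} {b : ℝ} (hb : 0 ≤ b) (D : LapData n) (Z : LS n) (hZ : lq Z = 0) {R : ℝ}
    (hR : 0 < R) (P : ℝ[X]) (hP : X ^ 3 ∣ P) :
    ∫ W, D.op b W * P.eval (tt Z R W) ∂(mw n b) =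
      (R ^ 2)⁻¹ * ∫ W, D.f W * (LP ((n : ℝ) + 2 + b) P).eval (tt Z R W) ∂(mw n b) := by
  have ev : ∀ P : ℝ[X], X ^ 1 ∣ P → P.eval 0 = 0 := by
    rintro P ⟨Q, rfl⟩; simp
  have e0 := ev P ((pow_dvd_pow X (by norm_num)).trans hP)
  have e1 := ev (derivative P) ((pow_dvd_pow X (by norm_num)).trans (dvd_deriv hP))
  have e2 := ev _ (dvd_deriv (dvd_deriv hP))
  have ht : ∀ W ∉ closedBall Z R, tt Z R W = 0 := fun W hW =>
    tt_zero hR (fun h => hW (ball_subset_closedBall h))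
  have := green hb D (testData Z hZ R P hP) (isCompact_closedBall Z R)
    (fun W hW => by simp [testData, ht W hW, e0])
    (fun i W hW => by simp [testData, ht W hW, e1])
    (fun i W hW => by simp [testData, ht W hW, e1, e2])
    (fun W hW => by simp [testData, ht W hW, e1])
  simp only [testData_op Z hZ hR] at this
  have hf : (testData Z hZ R P hP).f = fun W => P.eval (tt Z R W) := rfl
  rw [hf] at this
  rw [this, ← integral_const_mul]
  congr 1; ext W; ring

/-- closed half space -/
abbrev HS (n : ℕ) : Set (EuclideanSpace ℝ (Fin n) × ℝ) := {z | 0 ≤ z.2}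

lemma HS_nhds {n : ℕ} {z : EuclideanSpace ℝ (Fin n) × ℝ} (hz : 0 < z.2) : HS n ∈ 𝓝 z :=
  mem_of_superset ((isOpen_lt continuous_const continuous_snd).mem_nhds hz)
    (fun y (h : 0 < y.2) => (show 0 ≤ y.2 from le_of_lt h))

lemma HS_ud (n : ℕ) : UniqueDiffOn ℝ (HS n) := by
  refine uniqueDiffOn_convex ?_ ⟨(0, 1), mem_interior_iff_mem_nhds.2 (HS_nhds one_pos)⟩
  exact (convex_Ici (0 : ℝ)).linear_preimage (LinearMap.snd ℝ (EuclideanSpace ℝ (Fin n)) ℝ)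

/-- derivative within the half space -/
noncomputable def dwn (n : ℕ) (v : EuclideanSpace ℝ (Fin n) × ℝ)
    (f : EuclideanSpace ℝ (Fin n) × ℝ → ℝ) (z : EuclideanSpace ℝ (Fin n) × ℝ) : ℝ :=
  fderivWithin ℝ f (HS n) z v

lemma dwn_cd {n : ℕ} {v : EuclideanSpace ℝ (Fin n) × ℝ} {f : EuclideanSpace ℝ (Fin n) × ℝ → ℝ}
    {k m : WithTop ℕ∞} (h : ContDiffOn ℝ k f (HS n)) (hk : m + 1 ≤ k) :
    ContDiffOn ℝ m (dwn n v f) (HS n) := by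
  unfold dwn
  exact (h.fderivWithin (HS_ud n) hk).clm_apply contDiffOn_const

/-- the operator within -/
noncomputable def opAw (n : ℕ) (a : ℝ) (f : EuclideanSpace ℝ (Fin n) × ℝ → ℝ)
    (z : EuclideanSpace ℝ (Fin n) × ℝ) : ℝ :=
  z.2 * dwn n (0, 1) (dwn n (0, 1) f) z +
    (∑ i : Fin n,
      dwn n (EuclideanSpace.single i 1, 0) (dwn n (EuclideanSpace.single i 1, 0) f) z) +
    a * dwn n (0, 1) f z

lemma opAw_cd {n : ℕ} {a : ℝ} {f : EuclideanSpace ℝ (Fin n) × ℝ → ℝ} {m : ℕ}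
    (h : ContDiffOn ℝ ((m + 2 : ℕ) : WithTop ℕ∞) f (HS n)) :
    ContDiffOn ℝ (m : WithTop ℕ∞) (fun z => -opAw n a f z) (HS n) := by
  have h1 : ∀ v, ContDiffOn ℝ ((m + 1 : ℕ) : WithTop ℕ∞) (dwn n v f) (HS n) := fun v =>
    dwn_cd h (by norm_cast)
  have h2 : ∀ v, ContDiffOn ℝ (m : WithTop ℕ∞) (dwn n v (dwn n v f)) (HS n) := fun v =>
    dwn_cd (h1 v) (by norm_cast)
  have h1' : ∀ v, ContDiffOn ℝ (m : WithTop ℕ∞) (dwn n v f) (HS n) := fun v =>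
    (h1 v).of_le (by norm_cast; omega)
  unfold opAw
  refine ContDiffOn.neg (((contDiffOn_snd.mul (h2 _)).add (ContDiffOn.sum fun i _ => h2 _)).add
    (contDiffOn_const.mul (h1' _)))

lemma dwn_eq {n : ℕ} {v : EuclideanSpace ℝ (Fin n) × ℝ} {f g : EuclideanSpace ℝ (Fin n) × ℝ → ℝ}
    (h : ∀ z : EuclideanSpace ℝ (Fin n) × ℝ, 0 < z.2 → f z = g z) :
    ∀ z : EuclideanSpace ℝ (Fin n) × ℝ, 0 < z.2 → dwn n v f z = pdirP n v g z := by
  intro z hz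
  unfold dwn pdirP
  rw [fderivWithin_of_mem_nhds (HS_nhds hz)]
  have : f =ᶠ[𝓝 z] g := by
    filter_upwards [(isOpen_lt continuous_const continuous_snd).mem_nhds hz] with y hy
    exact h y hy
  rw [this.fderiv_eq]

lemma opAw_eq {n : ℕ} {a : ℝ} {f g : EuclideanSpace ℝ (Fin n) × ℝ → ℝ}
    (h : ∀ z : EuclideanSpace ℝ (Fin n) × ℝ, 0 < z.2 → f z = g z) :
    ∀ z : EuclideanSpace ℝ (Fin n) × ℝ, 0 < z.2 → opAw n a f z = opA n a g z := by
  intro z hz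
  unfold opAw opA
  rw [dwn_eq (dwn_eq h) z hz, dwn_eq h z hz]
  congr 2
  refine Finset.sum_congr rfl fun i _ => ?_
  rw [dwn_eq (dwn_eq h) z hz]

/-- lifting map -/
noncomputable def tau {n : ℕ} (W : LS n) : EuclideanSpace ℝ (Fin n) × ℝ :=
  (WithLp.toLp 2 fun i => W (Sum.inl i), (W (Sum.inr 0) ^ 2 + W (Sum.inr 1) ^ 2) / 4)

lemma tau_mem {n : ℕ} (W : LS n) : tau W ∈ HS n := by
  show 0 ≤ (W (Sum.inr 0) ^ 2 + W (Sum.inr 1) ^ 2) / 4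
  positivity

lemma tau_cont {n : ℕ} : Continuous (tau (n := n)) := by
  unfold tau
  fun_prop

lemma tau_line_inl {n : ℕ} (W : LS n) (i : Fin n) :
    HasDerivAt (fun t : ℝ => tau (W + t • eb (Sum.inl i))) (EuclideanSpace.single i 1, 0) 0 := by
  have : (fun t : ℝ => tau (W + t • eb (Sum.inl i))) =
      fun t => tau W + t • ((EuclideanSpace.single i 1, 0) : EuclideanSpace ℝ (Fin n) × ℝ) := by
    ext t j
    · simp [tau]
    · simp [tau]
  rw [this]
  simpa using ((hasDerivAt_id (0 : ℝ)).smul_const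
    ((EuclideanSpace.single i 1, 0) : EuclideanSpace ℝ (Fin n) × ℝ)).const_add (tau W)

lemma tau_line_inr {n : ℕ} (W : LS n) (j : Fin 2) :
    HasDerivAt (fun t : ℝ => tau (W + t • eb (Sum.inr j)))
      ((W (Sum.inr j) / 2) • ((0, 1) : EuclideanSpace ℝ (Fin n) × ℝ)) 0 := by
  have : (fun t : ℝ => tau (W + t • eb (Sum.inr j))) =
      fun t => tau W + (t * (W (Sum.inr j) / 2) + t ^ 2 / 4) •
        ((0, 1) : EuclideanSpace ℝ (Fin n) × ℝ) := by
    ext t k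
    · simp [tau]
    · fin_cases j <;> simp [tau] <;> ring
  rw [this]
  have h1 : HasDerivAt (fun t : ℝ => t * (W (Sum.inr j) / 2) + t ^ 2 / 4) (W (Sum.inr j) / 2) 0 := by
    refine (((hasDerivAt_id (0 : ℝ)).mul_const (W (Sum.inr j) / 2)).add
      ((hasDerivAt_pow 2 (0 : ℝ)).div_const 4)).congr_deriv ?_
    simp
  exact (h1.smul_const ((0, 1) : EuclideanSpace ℝ (Fin n) × ℝ)).const_add (tau W)

lemma lift_line_inl {n : ℕ} {f : EuclideanSpace ℝ (Fin n) × ℝ → ℝ}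
    (hf : ContDiffOn ℝ 1 f (HS n)) (W : LS n) (i : Fin n) :
    HasLineDerivAt ℝ (fun W => f (tau W)) (dwn n (EuclideanSpace.single i 1, 0) f (tau W)) W
      (eb (Sum.inl i)) := by
  unfold HasLineDerivAt
  have h1 := ((hf.differentiableOn one_ne_zero) (tau W) (tau_mem W)).hasFDerivWithinAt
  exact h1.comp_hasDerivAt_of_eq (0 : ℝ) (tau_line_inl W i)
    (Eventually.of_forall fun t => tau_mem _) (by simp)

lemma lift_line_inr {n : ℕ} {f : EuclideanSpace ℝ (Fin n) × ℝ → ℝ}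
    (hf : ContDiffOn ℝ 1 f (HS n)) (W : LS n) (j : Fin 2) :
    HasLineDerivAt ℝ (fun W => f (tau W)) (W (Sum.inr j) / 2 * dwn n (0, 1) f (tau W)) W
      (eb (Sum.inr j)) := by
  unfold HasLineDerivAt
  have h1 := ((hf.differentiableOn one_ne_zero) (tau W) (tau_mem W)).hasFDerivWithinAt
  have := h1.comp_hasDerivAt_of_eq (0 : ℝ) (tau_line_inr W j)
    (Eventually.of_forall fun t => tau_mem _) (by simp)
  rw [map_smul, smul_eq_mul] at this
  exact this

lemma lift_cont {n : ℕ} {f : EuclideanSpace ℝ (Fin n) × ℝ → ℝ}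
    {k : WithTop ℕ∞} (hf : ContDiffOn ℝ k f (HS n)) : Continuous fun W => f (tau W) :=
  hf.continuousOn.comp_continuous tau_cont tau_mem

lemma half_coord_line {n : ℕ} (W : LS n) (j : Fin 2) :
    HasLineDerivAt ℝ (fun W : LS n => W (Sum.inr j) / 2) (1 / 2) W (eb (Sum.inr j)) := by
  unfold HasLineDerivAt
  have : (fun t : ℝ => (W + t • eb (n := n) (Sum.inr j) : LS n) (Sum.inr j) / 2) =
    fun t => W (Sum.inr j) / 2 + t * (1 / 2) := by
    ext t; simp; ring
  rw [this]
  simpa using ((hasDerivAt_id (0 : ℝ)).mul_const (1 / 2)).const_add (W (Sum.inr j) / 2)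

/-- lifted data -/
noncomputable def liftData {n : ℕ} (f : EuclideanSpace ℝ (Fin n) × ℝ → ℝ)
    (hf : ContDiffOn ℝ 2 f (HS n)) : LapData n :=
  have h1 : ∀ v, ContDiffOn ℝ 1 (dwn n v f) (HS n) := fun v => dwn_cd hf (by norm_num)
  have h2 : ∀ v, ContDiffOn ℝ 0 (dwn n v (dwn n v f)) (HS n) := fun v =>
    dwn_cd (h1 v) (by norm_num)
  have hf1 : ContDiffOn ℝ 1 f (HS n) := hf.of_le (by norm_num)
  { f := fun W => f (tau W)
    f1 := fun i W => match i with
      | Sum.inl i => dwn n (EuclideanSpace.single i 1, 0) f (tau W)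
      | Sum.inr j => W (Sum.inr j) / 2 * dwn n (0, 1) f (tau W)
    f2 := fun i W => match i with
      | Sum.inl i => dwn n (EuclideanSpace.single i 1, 0)
          (dwn n (EuclideanSpace.single i 1, 0) f) (tau W)
      | Sum.inr j => 1 / 2 * dwn n (0, 1) f (tau W) + W (Sum.inr j) / 2 *
          (W (Sum.inr j) / 2 * dwn n (0, 1) (dwn n (0, 1) f) (tau W))
    h := fun W => 1 / 2 * dwn n (0, 1) f (tau W)
    h' := fun W => 1 / 2 * (W (Sum.inr 1) / 2 * dwn n (0, 1) (dwn n (0, 1) f) (tau W))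
    cf := lift_cont hf
    cf1 := fun i => by
      rcases i with i | j
      · exact lift_cont (h1 _)
      · have := lift_cont (h1 (0, 1))
        dsimp only
        fun_prop
    cf2 := fun i => by
      rcases i with i | j
      · exact lift_cont (h2 _)
      · have := lift_cont (h1 (0, 1))
        have := lift_cont (h2 (0, 1))
        dsimp only
        fun_prop
    ch := by
      have := lift_cont (h1 (0, 1))
      fun_prop
    ch' := by
      have := lift_cont (h2 (0, 1))
      fun_prop
    df := fun i W => by
      rcases i with i | j
      · exact lift_line_inl hf1 W i
      · exact lift_line_inr hf1 W j
    df1 := fun i W => by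
      rcases i with i | j
      · exact lift_line_inl (h1 _) W i
      · have k1 := lift_line_inr (h1 (0, 1)) W j
        have k2 := half_coord_line W j
        unfold HasLineDerivAt at *
        have := k2.mul k1
        simp only [zero_smul, add_zero] at this
        exact this
    dh := fun W => by
      have k1 := lift_line_inr (h1 (0, 1)) W 1
      unfold HasLineDerivAt at *
      exact k1.const_mul _
    e1 := fun W => by simp only [lq]; ring
    e2 := fun W => by simp only [lq]; ring }

lemma liftData_op {n : ℕ} (f : EuclideanSpace ℝ (Fin n) × ℝ → ℝ)
    (hf : ContDiffOn ℝ 2 f (HS n)) (a : ℝ) (W : LS n) :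
    (liftData f hf).op (2 * a - 2) W = opAw n a f (tau W) := by
  have h2 : (tau W).2 = (W (Sum.inr 0) ^ 2 + W (Sum.inr 1) ^ 2) / 4 := rfl
  simp only [LapData.op, liftData, Fintype.sum_sum_type, Fin.sum_univ_two, opAw, h2]
  ring

open Polynomial in
lemma test_step {n : ℕ} {a : ℝ} (ha : 1 ≤ a) {u : EuclideanSpace ℝ (Fin n) × ℝ → ℝ}
    {Z : LS n} (hZ : lq Z = 0) {R : ℝ} (hR : 0 < R) (k : ℕ) :
    ∀ m : ℕ, ContDiffOn ℝ ((2 * k + m : ℕ) : WithTop ℕ∞) u (HS n) →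
      ContDiffOn ℝ (m : WithTop ℕ∞) ((fun g z => -opAw n a g z)^[k] u) (HS n) ∧
      (∀ z : EuclideanSpace ℝ (Fin n) × ℝ, 0 < z.2 →
        (fun g z => -opAw n a g z)^[k] u z = negAIter n a k u z) ∧
      ∀ P : ℝ[X], X ^ (2 * k + 1) ∣ P →
        ∫ W, (fun g z => -opAw n a g z)^[k] u (tau W) * P.eval (tt Z R W) ∂(mw n (2 * a - 2)) =
        ((R ^ 2)⁻¹) ^ k * ∫ W, u (tau W) *
          ((fun P => -LP ((n : ℝ) + 2 + (2 * a - 2)) P)^[k] P).eval (tt Z R W)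
            ∂(mw n (2 * a - 2)) := by
  induction k with
  | zero =>
    intro m hm
    refine ⟨by simpa using hm, fun z hz => rfl, fun P _ => by simp⟩
  | succ k ih =>
    intro m hm
    obtain ⟨i1, i2, i3⟩ := ih (m + 2) (by convert! hm using 2; ring)
    simp only [Function.iterate_succ_apply']
    refine ⟨opAw_cd i1, ?_, ?_⟩
    · intro z hz
      unfold negAIter at *
      rw [Function.iterate_succ_apply', opAw_eq i2 z hz]
    · intro P hP
      have hc2 : ContDiffOn ℝ 2 ((fun g z => -opAw n a g z)^[k] u) (HS n) :=
        i1.of_le (by norm_cast; omega)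
      have g := green_test (b := 2 * a - 2) (by linarith) (liftData _ hc2) Z hZ hR P
        ((pow_dvd_pow X (by omega)).trans hP)
      simp only [liftData_op] at g
      have hd : X ^ (2 * k + 1) ∣ -LP ((n : ℝ) + 2 + (2 * a - 2)) P :=
        (dvd_LP (k := 2 * k + 1) (by convert! hP using 1)).neg_right
      have i4 := i3 _ hd
      simp only [neg_mul, integral_neg]
      rw [g]
      have hcm : -LP ((n : ℝ) + 2 + (2 * a - 2))
          ((fun P => -LP ((n : ℝ) + 2 + (2 * a - 2)) P)^[k] P) =
          (fun P => -LP ((n : ℝ) + 2 + (2 * a - 2)) P)^[k] (-LP ((n : ℝ) + 2 + (2 * a - 2)) P) :=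
        (Function.iterate_succ_apply' (fun P => -LP ((n : ℝ) + 2 + (2 * a - 2)) P) k P).symm.trans
          (Function.iterate_succ_apply _ k P)
      rw [hcm, pow_succ _ k, mul_comm (((R ^ 2)⁻¹) ^ k), mul_assoc, ← i4, ← mul_neg,
        ← integral_neg]
      congr 1
      refine integral_congr_ae (Eventually.of_forall fun W => ?_)
      simp only [eval_neg, mul_neg]
      rfl

lemma lq_ne_ae (n : ℕ) (b : ℝ) : ∀ᵐ W ∂(mw n b), lq W ≠ 0 := by
  refine (mw_ac n b).ae_le ?_
  filter_upwards [wt_pos_ae n 1] with W hW h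
  simp [wt, h] at hW

open Polynomial in
lemma test_identity {n p : ℕ} {a : ℝ} (ha : 1 ≤ a) {α : ℝ}
    {u : EuclideanSpace ℝ (Fin n) × ℝ → ℝ}
    (hreg : ContDiffOn ℝ (2 * p) u {z : EuclideanSpace ℝ (Fin n) × ℝ | 0 ≤ z.2})
    (heq : ∀ z : EuclideanSpace ℝ (Fin n) × ℝ, 0 < z.2 → negAIter n a p u z = u z ^ α)
    {Z : LS n} (hZ : lq Z = 0) {R : ℝ} (hR : 0 < R) (P : ℝ[X]) (hP : X ^ (2 * p + 1) ∣ P) :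
    ∫ W, u (tau W) ^ α * P.eval (tt Z R W) ∂(mw n (2 * a - 2)) =
        ((R ^ 2)⁻¹) ^ p * ∫ W, u (tau W) *
          ((fun P => -LP ((n : ℝ) + 2 + (2 * a - 2)) P)^[p] P).eval (tt Z R W)
            ∂(mw n (2 * a - 2)) := by
  obtain ⟨_, h2, h3⟩ := test_step (a := a) ha (u := u) hZ hR p 0 (by simpa using hreg)
  rw [← h3 P hP]
  refine integral_congr_ae ?_
  filter_upwards [lq_ne_ae n (2 * a - 2)] with W hW
  have : 0 < (tau W).2 := by
    show 0 < (W (Sum.inr 0) ^ 2 + W (Sum.inr 1) ^ 2) / 4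
    unfold lq at hW
    positivity
  rw [h2 _ this, heq _ this]

/-- abstract lifted solution -/
structure Sol (n p : ℕ) (b α : ℝ) (v : LS n → ℝ) : Prop where
  hb : 0 ≤ b
  hp : 1 ≤ p
  hα : 1 < α
  hN : 2 * (p : ℝ) < n + 2 + b
  cont : Continuous v
  nonneg : ∀ W, 0 ≤ v W
  test : ∀ Z : LS n, lq Z = 0 → ∀ R : ℝ, 0 < R → ∀ P : Polynomial ℝ, Polynomial.X ^ (2 * p + 1) ∣ P →
    ∫ W, v W ^ α * P.eval (tt Z R W) ∂(mw n b) =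
        ((R ^ 2)⁻¹) ^ p * ∫ W, v W *
          ((fun P => -LP ((n : ℝ) + 2 + b) P)^[p] P).eval (tt Z R W) ∂(mw n b)
  sym : ∀ W : LS n, ∃ W' : LS n, lq W' = 0 ∧ ‖W'‖ = ‖W‖ ∧ ∀ c : ℝ, v (c • W') = v (c • W)

lemma poly_bound {P : Polynomial ℝ} {k : ℕ} (h : Polynomial.X ^ k ∣ P) :
    ∃ C : ℝ, 0 < C ∧ ∀ t : ℝ, 0 ≤ t → t ≤ 1 → |P.eval t| ≤ C * t ^ k := by
  obtain ⟨Q, rfl⟩ := h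
  obtain ⟨C, hC⟩ := (isCompact_Icc (a := (0 : ℝ)) (b := 1)).exists_bound_of_continuousOn
    Q.continuous.continuousOn
  refine ⟨|C| + 1, by positivity, fun t h0 h1 => ?_⟩
  have := hC t ⟨h0, h1⟩
  rw [Real.norm_eq_abs] at this
  simp only [Polynomial.eval_mul, Polynomial.eval_pow, Polynomial.eval_X, abs_mul, abs_pow,
    abs_of_nonneg h0]
  rw [mul_comm]
  gcongr
  exact this.trans ((le_abs_self C).trans (by linarith))

lemma dvd_iter {N : ℝ} {j k : ℕ} : ∀ {P : Polynomial ℝ}, Polynomial.X ^ (k + 2 * j) ∣ P →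
    Polynomial.X ^ k ∣ (fun P => -LP N P)^[j] P := by
  induction j with
  | zero => intro P h; simpa using h
  | succ j ih =>
    intro P h
    rw [Function.iterate_succ_apply]
    apply ih
    exact (dvd_LP (by convert! h using 1)).neg_right

lemma young {α δ z : ℝ} (hα : 1 < α) (hδ : 0 < δ) (hz : 0 ≤ z) :
    z ≤ δ + δ ^ (1 - α) * z ^ α := by
  by_cases h : z ≤ δ
  · have : 0 ≤ δ ^ (1 - α) * z ^ α := by positivity
    linarith
  · push Not at h
    have hz' : 0 < z := hδ.trans h
    have h1 : z ^ (1 - α) ≤ δ ^ (1 - α) := Real.rpow_le_rpow_of_nonpos hδ h.le (by linarith)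
    have h2 : z = z ^ (1 - α) * z ^ α := by
      rw [← Real.rpow_add hz']; simp
    have h3 : z ^ (1 - α) * z ^ α ≤ δ ^ (1 - α) * z ^ α := by gcongr
    linarith

lemma tt_supp {n : ℕ} {Z : LS n} {R : ℝ} (hR : 0 < R) {f : LS n → ℝ → ℝ} (hf : ∀ W, f W 0 = 0) :
    HasCompactSupport fun W => f W (tt Z R W) := by
  refine HasCompactSupport.intro (isCompact_closedBall Z R) fun W hW => ?_
  rw [tt_zero hR (fun h => hW (ball_subset_closedBall h)), hf]

lemma mw_ball {n : ℕ} {b : ℝ} (hb : 0 ≤ b) {Z : LS n} (hZ : lq Z = 0) {R : ℝ} (hR : 0 < R) :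
    (mw n b).real (ball Z R) = R ^ ((n : ℝ) + 2 + b) * (mw n b).real (ball 0 1) := by
  have h1 : ∀ (Z : LS n) (R : ℝ), (mw n b).real (ball Z R) =
      ∫ W, (ball Z R).indicator (fun _ => (1 : ℝ)) W ∂(mw n b) := by
    intro Z R
    rw [integral_indicator measurableSet_ball]; simp
  rw [h1, h1, integral_translate hb hZ, integral_scale hb hR]
  congr 2
  ext W
  simp only [Set.indicator, mem_ball, dist_eq_norm, add_sub_cancel_right, sub_zero, norm_smul,
    Real.norm_eq_abs, abs_of_pos hR]
  have : R * ‖W‖ < R ↔ ‖W‖ < 1 := by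
    constructor <;> intro h <;> nlinarith
  simp only [this]

namespace Sol
variable {n p : ℕ} {b α : ℝ} {v : LS n → ℝ}

lemma int_pow (S : Sol n p b α v) (Z : LS n) {R : ℝ} (hR : 0 < R) {m : ℕ} (hm : m ≠ 0) :
    Integrable (fun W => v W ^ α * tt Z R W ^ m) (mw n b) := by
  refine integrable_of_cont_compact S.hb ?_ (tt_supp hR (f := fun W t => v W ^ α * t ^ m) ?_)
  · exact (S.cont.rpow_const (fun _ => Or.inr (by linarith [S.hα]))).mul ((tt_cont Z R).pow m)
  · simp [hm]

lemma int_poly (S : Sol n p b α v) (Z : LS n) {R : ℝ} (hR : 0 < R) {Q : Polynomial ℝ}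
    (hQ : Q.eval 0 = 0) :
    Integrable (fun W => v W * Q.eval (tt Z R W)) (mw n b) := by
  refine integrable_of_cont_compact S.hb ?_ (tt_supp hR (f := fun W t => v W * Q.eval t) ?_)
  · exact S.cont.mul (Q.continuous.comp (tt_cont Z R))
  · simp [hQ]

lemma absorb (S : Sol n p b α v) {k m : ℕ} (hm : m ≠ 0) (hk : (m : ℝ) / α ≤ k)
    {Q : Polynomial ℝ} {C : ℝ} (hC : 0 < C)
    (hQ : ∀ t : ℝ, 0 ≤ t → t ≤ 1 → |Q.eval t| ≤ C * t ^ k) {Z : LS n}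
    (hZ : lq Z = 0) {R δ : ℝ} (hR : 0 < R) (hδ : 0 < δ) :
    |∫ W, v W * Q.eval (tt Z R W) ∂(mw n b)| ≤
      C * (δ * (R ^ ((n : ℝ) + 2 + b) * (mw n b).real (ball 0 1)) +
        δ ^ (1 - α) * ∫ W, v W ^ α * tt Z R W ^ m ∂(mw n b)) := by
  have hα := S.hα
  have hk0 : k ≠ 0 := by
    rintro rfl
    have : 0 < (m : ℝ) / α := by positivity
    simp at hk; linarith
  have hQ0 : Q.eval 0 = 0 := by
    have := hQ 0 le_rfl zero_le_one
    simpa [hk0] using this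
  have hi2 : Integrable ((ball Z R).indicator fun _ => δ) (mw n b) :=
    (integrable_indicator_iff measurableSet_ball).2
      (integrableOn_const (mw_ball_lt_top n S.hb Z R).ne)
  have hi3 := (S.int_pow Z hR hm).const_mul (δ ^ (1 - α))
  have key : ∀ W, |v W * Q.eval (tt Z R W)| ≤
      C * ((ball Z R).indicator (fun _ => δ) W + δ ^ (1 - α) * (v W ^ α * tt Z R W ^ m)) := by
    intro W
    have hv := S.nonneg W
    by_cases hW : W ∈ ball Z R
    · rw [Set.indicator_of_mem hW]
      have ht := tt_nonneg Z R W
      have ht1 := tt_le_one Z R W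
      set t := tt Z R W
      have h1 := hQ t ht ht1
      have h2 : t ^ k ≤ t ^ ((m : ℝ) / α) := by
        rcases ht.eq_or_lt with h | h
        · rw [← h, zero_pow hk0]; positivity
        · rw [← Real.rpow_natCast]
          exact Real.rpow_le_rpow_of_exponent_ge h ht1 hk
      have h3 := young hα hδ (z := v W * t ^ ((m : ℝ) / α)) (by positivity)
      have h4 : (v W * t ^ ((m : ℝ) / α)) ^ α = v W ^ α * t ^ m := by
        rw [Real.mul_rpow hv (by positivity), ← Real.rpow_mul ht, div_mul_cancel₀ _ (by linarith),
          Real.rpow_natCast]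
      rw [h4] at h3
      rw [abs_mul, abs_of_nonneg hv]
      calc v W * |Q.eval t| ≤ v W * (C * t ^ k) := by gcongr
        _ ≤ v W * (C * t ^ ((m : ℝ) / α)) := by gcongr
        _ = C * (v W * t ^ ((m : ℝ) / α)) := by ring
        _ ≤ _ := by gcongr
    · rw [Set.indicator_of_notMem hW, tt_zero hR hW, hQ0]
      simp [hm]
  calc |∫ W, v W * Q.eval (tt Z R W) ∂(mw n b)| ≤ ∫ W, |v W * Q.eval (tt Z R W)| ∂(mw n b) :=
        abs_integral_le_integral_abs
    _ ≤ ∫ W, C * ((ball Z R).indicator (fun _ => δ) W + δ ^ (1 - α) * (v W ^ α * tt Z R W ^ m))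
          ∂(mw n b) := integral_mono (S.int_poly Z hR hQ0).abs ((hi2.add hi3).const_mul C) key
    _ = _ := by
      rw [integral_const_mul, integral_add hi2 hi3, integral_const_mul,
        integral_indicator measurableSet_ball, ← mw_ball S.hb hZ hR]
      simp [mul_comm]

lemma apriori (S : Sol n p b α v) {m : ℕ} (hm : 2 * p + 3 ≤ m) (hk : (m : ℝ) / α ≤ (m : ℝ) - 2 * p) :
    ∃ K : ℝ, 0 < K ∧ ∀ Z : LS n, lq Z = 0 → ∀ R : ℝ, 0 < R →
      ∫ W, v W ^ α * tt Z R W ^ m ∂(mw n b) ≤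
        K * R ^ ((n : ℝ) + 2 + b - 2 * p - 2 * p / (α - 1)) := by
  have hα := S.hα
  obtain ⟨k, rfl⟩ : ∃ k, m = k + 2 * p := ⟨m - 2 * p, by omega⟩
  obtain ⟨C, hC, hQ⟩ := poly_bound
    (dvd_iter (N := (n : ℝ) + 2 + b) (j := p) (k := k) (dvd_refl (Polynomial.X ^ (k + 2 * p))))
  have hB : 0 ≤ (mw n b).real (ball 0 1) := measureReal_nonneg
  set B := (mw n b).real (ball 0 1)
  set D : ℝ := (2 * C) ^ (1 / (α - 1)) with hD
  have hDpos : 0 < D := by positivity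
  have hD1 : C * D ^ (1 - α) = 1 / 2 := by
    rw [hD, ← Real.rpow_mul (by positivity)]
    have : 1 / (α - 1) * (1 - α) = -1 := by
      have : α - 1 ≠ 0 := by linarith
      field_simp; ring
    rw [this, Real.rpow_neg_one]; field_simp
  refine ⟨2 * C * D * B + 1, by positivity, fun Z hZ R hR => ?_⟩
  have h1 := S.test Z hZ R hR (Polynomial.X ^ (k + 2 * p)) (pow_dvd_pow _ (by omega))
  simp only [Polynomial.eval_pow, Polynomial.eval_X] at h1
  have h2 := S.absorb (k := k) (m := k + 2 * p) (by omega) (by push_cast at hk ⊢; linarith) hC hQ hZ hR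
    (δ := D * R ^ (-(2 * p / (α - 1)))) (by positivity)
  set I := ∫ W, v W ^ α * tt Z R W ^ (k + 2 * p) ∂(mw n b)
  have hRp : ((R ^ 2)⁻¹) ^ p = R ^ (-(2 * p : ℝ)) := by
    rw [Real.rpow_neg hR.le, inv_pow, ← pow_mul, ← Real.rpow_natCast]; push_cast; rfl
  have h3 : (D * R ^ (-(2 * p / (α - 1)))) ^ (1 - α) = D ^ (1 - α) * R ^ (2 * p : ℝ) := by
    rw [Real.mul_rpow hDpos.le (by positivity), ← Real.rpow_mul hR.le]
    congr 2
    have : α - 1 ≠ 0 := by linarith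
    field_simp; ring
  rw [h3] at h2
  have h4 : I ≤ R ^ (-(2 * p : ℝ)) * (C * (D * R ^ (-(2 * p / (α - 1))) * (R ^ ((n : ℝ) + 2 + b) * B)
      + D ^ (1 - α) * R ^ (2 * p : ℝ) * I)) := by
    rw [hRp] at h1
    exact h1.le.trans (mul_le_mul_of_nonneg_left ((le_abs_self _).trans h2) (by positivity))
  have h5 : R ^ (-(2 * p : ℝ)) * R ^ (2 * p : ℝ) = 1 := by
    rw [← Real.rpow_add hR]; simp
  have h6 : R ^ ((n : ℝ) + 2 + b - 2 * p - 2 * p / (α - 1)) =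
      R ^ (-(2 * p : ℝ)) * R ^ (-(2 * p / (α - 1))) * R ^ ((n : ℝ) + 2 + b) := by
    rw [← Real.rpow_add hR, ← Real.rpow_add hR]; congr 1; ring
  have h7 : I ≤ 2 * C * D * B * R ^ ((n : ℝ) + 2 + b - 2 * p - 2 * p / (α - 1)) := by
    rw [h6]
    have : R ^ (-(2 * p : ℝ)) * (C * (D * R ^ (-(2 * p / (α - 1))) * (R ^ ((n : ℝ) + 2 + b) * B)
      + D ^ (1 - α) * R ^ (2 * p : ℝ) * I)) =
      C * D * B * (R ^ (-(2 * p : ℝ)) * R ^ (-(2 * p / (α - 1))) * R ^ ((n : ℝ) + 2 + b)) +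
      (C * D ^ (1 - α)) * (R ^ (-(2 * p : ℝ)) * R ^ (2 * p : ℝ)) * I := by ring
    rw [this, hD1, h5] at h4
    linarith
  refine h7.trans ?_
  gcongr
  linarith

lemma apriori2 (S : Sol n p b α v) {m k : ℕ} (hm : 2 * p + 3 ≤ m)
    (hk : (m : ℝ) / α ≤ (m : ℝ) - 2 * p) (hkk : (m : ℝ) - 2 * p ≤ k)
    {Q : Polynomial ℝ} (hQd : Polynomial.X ^ k ∣ Q) :
    ∃ K : ℝ, 0 < K ∧ ∀ Z : LS n, lq Z = 0 → ∀ R : ℝ, 0 < R →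
      |∫ W, v W * Q.eval (tt Z R W) ∂(mw n b)| ≤
        K * R ^ ((n : ℝ) + 2 + b - 2 * p / (α - 1)) := by
  have hα := S.hα
  obtain ⟨K, hK, hI⟩ := S.apriori hm hk
  obtain ⟨C, hC, hQ⟩ := poly_bound hQd
  have hB : 0 ≤ (mw n b).real (ball 0 1) := measureReal_nonneg
  set B := (mw n b).real (ball 0 1)
  refine ⟨C * (B + K), by positivity, fun Z hZ R hR => ?_⟩
  have h2 := S.absorb (k := k) (m := m) (by omega) (by linarith) hC hQ hZ hR
    (δ := R ^ (-(2 * p / (α - 1)))) (by positivity)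
  have h3 : (R ^ (-(2 * p / (α - 1)))) ^ (1 - α) = R ^ (2 * p : ℝ) := by
    rw [← Real.rpow_mul hR.le]
    congr 1
    have : α - 1 ≠ 0 := by linarith
    field_simp; ring
  rw [h3] at h2
  refine h2.trans ?_
  rw [mul_assoc]
  gcongr
  have h4 := hI Z hZ R hR
  have h5 : R ^ (-(2 * p / (α - 1))) * (R ^ ((n : ℝ) + 2 + b) * B) =
    B * R ^ ((n : ℝ) + 2 + b - 2 * p / (α - 1)) := by
    rw [← mul_assoc, ← Real.rpow_add hR, mul_comm]; congr 2; ring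
  have h6 : R ^ (2 * p : ℝ) * (K * R ^ ((n : ℝ) + 2 + b - 2 * p - 2 * p / (α - 1))) =
    K * R ^ ((n : ℝ) + 2 + b - 2 * p / (α - 1)) := by
    rw [mul_left_comm, ← Real.rpow_add hR]; congr 2; ring
  rw [h5, add_mul, ← h6]
  gcongr

end Sol

open Polynomial in
lemma radial_deriv {N : ℝ} {ψ : ℝ[X]} (hψ : X ^ 2 ∣ ψ) (ρ : ℝ) {R : ℝ} (hR : 0 < R) :
    HasDerivAt (fun R : ℝ => R ^ (-N) * ψ.eval (max (1 - ρ ^ 2 / R ^ 2) 0))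
      (-(R ^ (-N - 1) * (C N * ψ - 2 * (1 - X) * derivative ψ).eval
        (max (1 - ρ ^ 2 / R ^ 2) 0))) R := by
  have h1 : HasDerivAt (fun R : ℝ => 1 - ρ ^ 2 / R ^ 2) (2 * ρ ^ 2 / R ^ 3) R := by
    have := ((hasDerivAt_const R (ρ ^ 2)).div (hasDerivAt_pow 2 R) (by positivity)).const_sub 1
    refine this.congr_deriv ?_
    field_simp
    simp; ring
  have h2 := (poly_max_deriv hψ (1 - ρ ^ 2 / R ^ 2)).comp R h1
  have h3 := Real.hasDerivAt_rpow_const (x := R) (p := -N) (Or.inl hR.ne')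
  refine (h3.mul h2).congr_deriv ?_
  have hd : (derivative ψ).eval 0 = 0 := by
    obtain ⟨Q, hQ⟩ := dvd_deriv (k := 1) hψ
    rw [hQ]; simp
  have hp : R ^ (-N) = R ^ (-N - 1) * R := by
    rw [← Real.rpow_add_one hR.ne']; simp
  simp only [eval_sub, eval_mul, eval_C, eval_one, eval_X, eval_ofNat, comp_apply]
  rw [hp]
  rcases le_total (1 - ρ ^ 2 / R ^ 2) 0 with h | h
  · rw [max_eq_right h, hd]; ring
  · rw [max_eq_left h]; field_simp; ring

open Polynomial in
lemma LP_eq (N : ℝ) (Q : ℝ[X]) : -LP N Q =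
    C N * (2 * derivative Q) - 2 * (1 - X) * derivative (2 * derivative Q) := by
  unfold LP
  have : derivative (2 * derivative Q) = 2 * derivative (derivative Q) := by
    rw [derivative_mul]; simp
  rw [this, C_mul]
  simp only [map_ofNat]
  ring

open Polynomial in
lemma radial_int {N : ℝ} {ψ : ℝ[X]} (hψ : X ^ 2 ∣ ψ) (ρ : ℝ) {ε M : ℝ} (hε : 0 < ε) (hM : ε ≤ M) :
    ∫ R in Set.Icc ε M, R ^ (-N - 1) * (C N * ψ - 2 * (1 - X) * derivative ψ).eval
        (max (1 - ρ ^ 2 / R ^ 2) 0) =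
      ε ^ (-N) * ψ.eval (max (1 - ρ ^ 2 / ε ^ 2) 0) - M ^ (-N) * ψ.eval (max (1 - ρ ^ 2 / M ^ 2) 0) := by
  rw [integral_Icc_eq_integral_Ioc, ← intervalIntegral.integral_of_le hM]
  have hpos : ∀ R ∈ Set.uIcc ε M, 0 < R := fun R hR => by
    rw [Set.uIcc_of_le hM] at hR; exact hε.trans_le hR.1
  have := intervalIntegral.integral_eq_sub_of_hasDerivAt
    (fun R hR => radial_deriv (N := N) hψ ρ (hpos R hR)) (ContinuousOn.intervalIntegrable ?_)
  · rw [intervalIntegral.integral_neg] at this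
    linarith
  · refine ContinuousOn.neg (ContinuousOn.mul ?_ ?_)
    · exact continuousOn_id.rpow_const fun R hR => Or.inl (hpos R hR).ne'
    · refine (Polynomial.continuous _).comp_continuousOn (ContinuousOn.sup ?_ continuousOn_const)
      refine continuousOn_const.sub (ContinuousOn.div continuousOn_const (by fun_prop) ?_)
      intro R hR
      have := hpos R hR
      positivity

lemma mw_sf (n : ℕ) {b : ℝ} (hb : 0 ≤ b) : SigmaFinite (mw n b) := by
  have := mw_locfin n hb
  infer_instance

lemma tt_cont2 {n : ℕ} (Z : LS n) : ContinuousOn (fun q : ℝ × LS n => tt Z q.1 q.2)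
    {q | 0 < q.1} := by
  unfold tt
  refine ContinuousOn.sup ?_ continuousOn_const
  refine continuousOn_const.sub (ContinuousOn.div (by fun_prop) (by fun_prop) ?_)
  intro q hq
  have : 0 < q.1 := hq
  positivity

lemma prod_int {n : ℕ} {b : ℝ} (hb : 0 ≤ b) (Z : LS n) {g : LS n → ℝ} (hg : Continuous g) (e : ℝ)
    (F : Polynomial ℝ) {ε M : ℝ} (hε : 0 < ε) :
    Integrable (fun q : ℝ × LS n => q.1 ^ e * (g q.2 * F.eval (tt Z q.1 q.2)))
      (((volume : Measure ℝ).restrict (Set.Icc ε M)).prod ((mw n b).restrict (closedBall Z M))) := by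
  have := mw_locfin n hb
  have := mw_sf n hb
  rw [Measure.prod_restrict]
  refine ContinuousOn.integrableOn_compact (isCompact_Icc.prod (isCompact_closedBall Z M)) ?_
  have hpos : ∀ q ∈ Set.Icc ε M ×ˢ closedBall Z M, 0 < q.1 := fun q hq => hε.trans_le hq.1.1
  refine ContinuousOn.mul ?_ (ContinuousOn.mul (by fun_prop) ?_)
  · exact continuousOn_fst.rpow_const fun q hq => Or.inl (hpos q hq).ne'
  · exact F.continuous.comp_continuousOn ((tt_cont2 Z).mono hpos)

lemma restrict_ball {n : ℕ} {b : ℝ} (Z : LS n) {g : LS n → ℝ}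
    {F : Polynomial ℝ} (hF : F.eval 0 = 0) {R M : ℝ} (hR : 0 < R) (hM : R ≤ M) :
    ∫ W in closedBall Z M, g W * F.eval (tt Z R W) ∂(mw n b) =
      ∫ W, g W * F.eval (tt Z R W) ∂(mw n b) := by
  apply setIntegral_eq_integral_of_forall_compl_eq_zero
  intro W hW
  rw [tt_zero hR, hF, mul_zero]
  exact fun h => hW (ball_subset_closedBall (ball_subset_ball hM h))

namespace Sol
variable {n p : ℕ} {b α : ℝ} {v : LS n → ℝ}

open Polynomial in
/-- the auxiliary polynomial -/
noncomputable def psi (N : ℝ) (p m : ℕ) : ℝ[X] := 2 * derivative ((fun P => -LP N P)^[p - 1] (X ^ m))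

open Polynomial in
lemma psi_dvd (N : ℝ) {p m k : ℕ} (hp : 1 ≤ p) (h : m = k + 2 * p) : X ^ (k + 1) ∣ psi N p m := by
  unfold psi
  refine Dvd.dvd.mul_left (dvd_deriv ?_) _
  apply dvd_iter
  exact pow_dvd_pow _ (by omega)

open Polynomial in
lemma psi_eq (N : ℝ) {p : ℕ} (hp : 1 ≤ p) (m : ℕ) : (fun P => -LP N P)^[p] (X ^ m) =
    C N * psi N p m - 2 * (1 - X) * derivative (psi N p m) := by
  obtain ⟨q, rfl⟩ : ∃ q, p = q + 1 := ⟨p - 1, by omega⟩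
  rw [Function.iterate_succ_apply']
  exact LP_eq _ _

open Polynomial in
lemma repr_real (S : Sol n p b α v) {m : ℕ} (hm : 2 * p + 3 ≤ m) {Z : LS n} (hZ : lq Z = 0)
    {ε M : ℝ} (hε : 0 < ε) (hM : ε ≤ M) :
    IntegrableOn (fun R : ℝ => R ^ (2 * p - ((n : ℝ) + 2 + b) - 1) * ∫ W, v W ^ α * tt Z R W ^ m ∂(mw n b))
      (Set.Icc ε M) ∧
    ∫ R in Set.Icc ε M, R ^ (2 * p - ((n : ℝ) + 2 + b) - 1) * ∫ W, v W ^ α * tt Z R W ^ m ∂(mw n b) =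
      ε ^ (-((n : ℝ) + 2 + b)) * ∫ W, v W * (psi ((n : ℝ) + 2 + b) p m).eval (tt Z ε W) ∂(mw n b) -
      M ^ (-((n : ℝ) + 2 + b)) * ∫ W, v W * (psi ((n : ℝ) + 2 + b) p m).eval (tt Z M W) ∂(mw n b) := by
  have := mw_sf n S.hb
  obtain ⟨k, rfl⟩ : ∃ k, m = k + 2 * p := ⟨m - 2 * p, by omega⟩
  set N := (n : ℝ) + 2 + b with hN
  have hpsi := psi_dvd N S.hp (k := k) rfl
  set ψ := psi N p (k + 2 * p) with hψ
  have hF := psi_eq N S.hp (k + 2 * p)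
  rw [← hψ] at hF
  set F := (fun P => -LP N P)^[p] (X ^ (k + 2 * p) : ℝ[X]) with hFdef
  have hF0 : F.eval 0 = 0 := by
    obtain ⟨Q, hQ⟩ := dvd_iter (N := N) (j := p) (k := k) (dvd_refl (X ^ (k + 2 * p)))
    rw [hFdef, hQ]; simp; left; omega
  have hψ0 : ψ.eval 0 = 0 := by
    obtain ⟨Q, hQ⟩ := hpsi
    rw [hQ]; simp
  have key : ∀ R ∈ Set.Icc ε M, R ^ (2 * p - N - 1) * ∫ W, v W ^ α * tt Z R W ^ (k + 2 * p) ∂(mw n b) =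
      ∫ W in closedBall Z M, R ^ (-N - 1) * (v W * F.eval (tt Z R W)) ∂(mw n b) := by
    intro R hR
    have hR0 : 0 < R := hε.trans_le hR.1
    have h1 := S.test Z hZ R hR0 (X ^ (k + 2 * p)) (pow_dvd_pow _ (by omega))
    simp only [eval_pow, eval_X] at h1
    rw [integral_const_mul, restrict_ball Z hF0 hR0 hR.2, h1, ← mul_assoc]
    congr 1
    rw [inv_pow, ← pow_mul, ← Real.rpow_natCast, ← Real.rpow_neg hR0.le, ← Real.rpow_add hR0]
    congr 1
    push_cast
    ring
  have hprodint := prod_int S.hb Z S.cont (-N - 1) F (M := M) hε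
  constructor
  · refine IntegrableOn.congr_fun ?_ (fun R hR => (key R hR).symm) measurableSet_Icc
    exact hprodint.integral_prod_left
  · rw [setIntegral_congr_fun measurableSet_Icc key, integral_integral_swap hprodint]
    have h2 : ∀ W, ∫ R in Set.Icc ε M, R ^ (-N - 1) * (v W * F.eval (tt Z R W)) =
        ε ^ (-N) * (v W * ψ.eval (tt Z ε W)) - M ^ (-N) * (v W * ψ.eval (tt Z M W)) := by
      intro W
      have h3 := radial_int (N := N) (ψ := ψ) ((pow_dvd_pow X (by omega)).trans hpsi) ‖W - Z‖ hε hM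
      rw [← hF] at h3
      have h4 : ∀ R : ℝ, R ^ (-N - 1) * (v W * F.eval (tt Z R W)) =
        v W * (R ^ (-N - 1) * F.eval (max (1 - ‖W - Z‖ ^ 2 / R ^ 2) 0)) := fun R => by
        simp only [tt]; ring
      simp only [h4]
      rw [integral_const_mul, h3]
      simp only [tt]
      ring
    simp only [h2]
    rw [integral_sub, integral_const_mul, integral_const_mul,
      restrict_ball Z hψ0 hε hM, restrict_ball Z hψ0 (hε.trans_le hM) le_rfl]
    · exact ((S.int_poly Z hε hψ0).const_mul _).integrableOn
    · exact ((S.int_poly Z (hε.trans_le hM) hψ0).const_mul _).integrableOn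

end Sol

/-- radial kernel -/
noncomputable def Phi (e : ℝ) (m : ℕ) (ρ : ℝ) : ENNReal :=
  ∫⁻ R in Set.Ioi (0 : ℝ), ENNReal.ofReal (R ^ (e - 1) * max (1 - ρ ^ 2 / R ^ 2) 0 ^ m)

lemma Phi_scale (e : ℝ) (m : ℕ) {ρ : ℝ} (hρ : 0 < ρ) :
    Phi e m ρ = ENNReal.ofReal (ρ ^ e) * Phi e m 1 := by
  unfold Phi
  have him : (fun x : ℝ => ρ * x) '' Set.Ioi 0 = Set.Ioi 0 := by
    ext y
    simp only [Set.mem_image, Set.mem_Ioi]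
    constructor
    · rintro ⟨x, hx, rfl⟩; positivity
    · intro hy; exact ⟨y / ρ, by positivity, by field_simp⟩
  have := lintegral_image_eq_lintegral_abs_deriv_mul (s := Set.Ioi (0 : ℝ)) (f := fun x => ρ * x)
    (f' := fun _ => ρ) measurableSet_Ioi
    (fun x _ => by simpa using ((hasDerivAt_id x).const_mul ρ).hasDerivWithinAt)
    (fun x _ y _ h => mul_left_cancel₀ hρ.ne' h)
    (fun R => ENNReal.ofReal (R ^ (e - 1) * max (1 - ρ ^ 2 / R ^ 2) 0 ^ m))
  rw [him] at this
  rw [this, ← lintegral_const_mul']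
  · refine setLIntegral_congr_fun measurableSet_Ioi fun R (hR : 0 < R) => ?_
    rw [← ENNReal.ofReal_mul (abs_nonneg _), ← ENNReal.ofReal_mul (by positivity)]
    congr 1
    have h1 : ρ ^ e = ρ ^ (e - 1) * ρ := by
      rw [← Real.rpow_add_one hρ.ne']; simp
    have h2 : ρ ^ 2 / (ρ * R) ^ 2 = 1 ^ 2 / R ^ 2 := by field_simp
    rw [abs_of_pos hρ, Real.mul_rpow hρ.le hR.le, h1, h2]
    ring
  · exact ENNReal.ofReal_ne_top

lemma Phi_ne_zero (e : ℝ) (m : ℕ) : Phi e m 1 ≠ 0 := by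
  unfold Phi
  rw [← pos_iff_ne_zero, setLIntegral_pos_iff (by fun_prop)]
  refine lt_of_lt_of_le (b := volume (Set.Ioi (1 : ℝ))) (by simp) (measure_mono ?_)
  intro R (hR : 1 < R)
  have : 0 < 1 - (1 : ℝ) ^ 2 / R ^ 2 := by
    rw [sub_pos, div_lt_one (by positivity)]; nlinarith
  refine ⟨?_, zero_lt_one.trans hR⟩
  rw [mem_support, ← pos_iff_ne_zero, ENNReal.ofReal_pos, max_eq_left this.le]
  positivity

lemma Phi_ne_top {e : ℝ} (he : e < 0) {m : ℕ} (hm : m ≠ 0) : Phi e m 1 ≠ ⊤ := by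
  unfold Phi
  have h1 : IntegrableOn (fun R : ℝ => R ^ (e - 1)) (Set.Ioi 1) :=
    integrableOn_Ioi_rpow_of_lt (by linarith) one_pos
  have h2 : ∫⁻ R in Set.Ioi (0 : ℝ), ENNReal.ofReal (R ^ (e - 1) * max (1 - 1 ^ 2 / R ^ 2) 0 ^ m) ≤
      ∫⁻ R in Set.Ioi (0 : ℝ), (Set.Ioi (1 : ℝ)).indicator (fun R => ENNReal.ofReal (R ^ (e - 1))) R := by
    refine setLIntegral_mono' measurableSet_Ioi fun R (hR : 0 < R) => ?_
    by_cases h : R ∈ Set.Ioi (1 : ℝ)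
    · rw [Set.indicator_of_mem h]
      refine ENNReal.ofReal_le_ofReal ?_
      have : max (1 - 1 ^ 2 / R ^ 2) 0 ^ m ≤ 1 := by
        refine pow_le_one₀ (le_max_right _ _) (max_le ?_ zero_le_one)
        have : 0 ≤ (1 : ℝ) ^ 2 / R ^ 2 := by positivity
        linarith
      have h3 : 0 ≤ R ^ (e - 1) := by positivity
      nlinarith
    · rw [Set.indicator_of_notMem h]
      simp only [Set.mem_Ioi, not_lt] at h
      rw [max_eq_right]
      · simp [hm]
      · rw [sub_nonpos, one_le_div (by positivity)]; nlinarith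
  refine ne_top_of_le_ne_top ?_ h2
  rw [setLIntegral_indicator measurableSet_Ioi]
  have h3 := h1.lintegral_lt_top.ne
  refine ne_top_of_le_ne_top h3 (lintegral_mono_set Set.inter_subset_left)

namespace Sol
variable {n p : ℕ} {b α : ℝ} {v : LS n → ℝ}

lemma exists_m (S : Sol n p b α v) : ∃ m : ℕ, 2 * p + 3 ≤ m ∧ (m : ℝ) / α ≤ (m : ℝ) - 2 * p := by
  have hα := S.hα
  obtain ⟨m, hm⟩ := exists_nat_ge (2 * p * α / (α - 1))
  refine ⟨max m (2 * p + 3), le_max_right _ _, ?_⟩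
  have h1 : 2 * p * α / (α - 1) ≤ ((max m (2 * p + 3) : ℕ) : ℝ) :=
    hm.trans (by exact_mod_cast le_max_left _ _)
  rw [div_le_iff₀ (by linarith)] at h1 ⊢
  nlinarith

lemma lim_zero (S : Sol n p b α v) {Q : Polynomial ℝ} (hQ : Q.eval 0 = 0) {Z : LS n}
    (hZ : lq Z = 0) :
    Tendsto (fun ε : ℝ => ε ^ (-((n : ℝ) + 2 + b)) * ∫ W, v W * Q.eval (tt Z ε W) ∂(mw n b))
      (𝓝[>] 0) (𝓝 (v Z * ∫ W, Q.eval (tt 0 1 W) ∂(mw n b))) := by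
  have := mw_locfin n S.hb
  have h1 : ∀ ε : ℝ, 0 < ε → ε ^ (-((n : ℝ) + 2 + b)) * ∫ W, v W * Q.eval (tt Z ε W) ∂(mw n b) =
      ∫ W in closedBall 0 1, v (ε • W + Z) * Q.eval (tt 0 1 W) ∂(mw n b) := by
    intro ε hε
    rw [restrict_ball (g := fun W => v (ε • W + Z)) 0 hQ one_pos le_rfl, integral_translate S.hb hZ,
      integral_scale S.hb hε, ← mul_assoc, ← Real.rpow_add hε]
    simp only [neg_add_cancel, Real.rpow_zero, one_mul]
    refine integral_congr_ae (Eventually.of_forall fun W => ?_)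
    simp only
    congr 2
    simp only [tt, add_sub_cancel_right, sub_zero, norm_smul, Real.norm_eq_abs, mul_pow, sq_abs]
    congr 2
    field_simp
  have hc : Continuous fun ε : ℝ => ∫ W in closedBall 0 1, v (ε • W + Z) * Q.eval (tt 0 1 W) ∂(mw n b) := by
    refine continuous_parametric_integral_of_continuous
      (f := fun ε W => v (ε • W + Z) * Q.eval (tt 0 1 W)) ?_ (isCompact_closedBall 0 1)
    refine (S.cont.comp ?_).mul ((Q.continuous.comp (tt_cont 0 1)).comp continuous_snd)
    fun_prop
  have h2 := (hc.tendsto 0).mono_left (nhdsWithin_le_nhds (s := Set.Ioi 0))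
  have h3 : ∫ W in closedBall 0 1, v ((0 : ℝ) • W + Z) * Q.eval (tt 0 1 W) ∂(mw n b) =
      v Z * ∫ W, Q.eval (tt 0 1 W) ∂(mw n b) := by
    simp only [zero_smul, zero_add]
    rw [restrict_ball (g := fun W => v Z) 0 hQ one_pos le_rfl, integral_const_mul]
  rw [h3] at h2
  refine h2.congr' ?_
  filter_upwards [self_mem_nhdsWithin] with ε hε
  exact (h1 ε hε).symm

open Polynomial in
lemma repr0 (S : Sol n p b α v) {m : ℕ} (hm : 2 * p + 3 ≤ m) (hk : (m : ℝ) / α ≤ (m : ℝ) - 2 * p)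
    {Z : LS n} (hZ : lq Z = 0) :
    ENNReal.ofReal (v Z * ∫ W, (psi ((n : ℝ) + 2 + b) p m).eval (tt 0 1 W) ∂(mw n b)) =
      ∫⁻ W, ENNReal.ofReal (v W ^ α) * Phi (2 * p - ((n : ℝ) + 2 + b)) m ‖W - Z‖ ∂(mw n b) := by
  have := mw_sf n S.hb
  have hα := S.hα
  set N := (n : ℝ) + 2 + b with hN
  set e := 2 * p - N with he
  have hdvd := psi_dvd N S.hp (show m = (m - 2 * p) + 2 * p by omega)
  set ψ := psi N p m with hψ
  have hψ0 : ψ.eval 0 = 0 := by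
    obtain ⟨Q, hQ⟩ := hdvd
    rw [hQ]; simp
  set f : ℝ → LS n → ENNReal := fun R W => ENNReal.ofReal (R ^ (e - 1) * (v W ^ α * tt Z R W ^ m)) with hf
  have hfm : Measurable (uncurry f) := by
    have := S.cont.measurable
    refine ENNReal.measurable_ofReal.comp ?_
    refine Measurable.mul (by fun_prop) (Measurable.mul (by fun_prop) ?_)
    unfold tt
    fun_prop
  set h : ℝ → ENNReal := fun R => ∫⁻ W, f R W ∂(mw n b) with hh
  have hh1 : ∀ R : ℝ, 0 < R → h R = ENNReal.ofReal (R ^ (e - 1) * ∫ W, v W ^ α * tt Z R W ^ m ∂(mw n b)) := by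
    intro R hR
    rw [hh, ← integral_const_mul, ofReal_integral_eq_lintegral_ofReal]
    · exact (S.int_pow Z hR (by omega)).const_mul _
    · refine Eventually.of_forall fun W => ?_
      have := S.nonneg W
      have := tt_nonneg Z R W
      simp only [Pi.zero_apply]
      positivity
  set G : ℝ → ℝ := fun R => R ^ (-N) * ∫ W, v W * ψ.eval (tt Z R W) ∂(mw n b) with hG
  have hh2 : ∀ ε M : ℝ, 0 < ε → ε ≤ M → ∫⁻ R in Set.Icc ε M, h R = ENNReal.ofReal (G ε - G M) := by
    intro ε M hε hM
    obtain ⟨h1, h2⟩ := S.repr_real hm hZ hε hM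
    rw [← h2, ofReal_integral_eq_lintegral_ofReal h1]
    · exact setLIntegral_congr_fun measurableSet_Icc fun R hR => hh1 R (hε.trans_le hR.1)
    · refine (ae_restrict_iff' measurableSet_Icc).2 (Eventually.of_forall fun R hR => ?_)
      have hR0 : 0 < R := hε.trans_le hR.1
      have : 0 ≤ ∫ W, v W ^ α * tt Z R W ^ m ∂(mw n b) := integral_nonneg fun W => by
        have := S.nonneg W
        have := tt_nonneg Z R W
        simp only [Pi.zero_apply]
        positivity
      simp only [Pi.zero_apply]
      positivity
  -- limits
  have l1 : Tendsto G (𝓝[>] 0) (𝓝 (v Z * ∫ W, ψ.eval (tt 0 1 W) ∂(mw n b))) := S.lim_zero hψ0 hZ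
  have l2 : Tendsto G atTop (𝓝 0) := by
    obtain ⟨K, hK, hb2⟩ := S.apriori2 hm hk (k := m - 2 * p + 1) (by
      rw [Nat.cast_add, Nat.cast_sub (by omega)]; push_cast; linarith) hdvd
    have hg : 0 < 2 * p / (α - 1) := by
      have := S.hp
      have h1 : 0 < α - 1 := by linarith
      positivity
    have t1 : Tendsto (fun R : ℝ => K * R ^ (-(2 * p / (α - 1)))) atTop (𝓝 0) := by
      simpa using (tendsto_rpow_neg_atTop hg).const_mul K
    refine squeeze_zero_norm' ?_ t1
    filter_upwards [eventually_gt_atTop 0] with R hR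
    rw [Real.norm_eq_abs, hG, abs_mul, abs_of_nonneg (by positivity : 0 ≤ R ^ (-N))]
    calc R ^ (-N) * |∫ W, v W * ψ.eval (tt Z R W) ∂(mw n b)| ≤
        R ^ (-N) * (K * R ^ (N - 2 * p / (α - 1))) := by
          gcongr; exact hb2 Z hZ R hR
      _ = K * R ^ (-(2 * p / (α - 1))) := by
        rw [mul_left_comm, ← Real.rpow_add hR]; congr 2; ring
  have e1 : Tendsto (fun k : ℕ => 1 / ((k : ℝ) + 1)) atTop (𝓝[>] 0) :=
    tendsto_nhdsWithin_iff.2 ⟨tendsto_one_div_add_atTop_nhds_zero_nat,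
      Eventually.of_forall fun k => by simp only [Set.mem_Ioi]; positivity⟩
  have e2 : Tendsto (fun k : ℕ => (k : ℝ) + 1) atTop atTop :=
    tendsto_atTop_add_const_right _ _ tendsto_natCast_atTop_atTop
  have l3 := ENNReal.tendsto_ofReal ((l1.comp e1).sub (l2.comp e2))
  rw [sub_zero] at l3
  -- monotone limit
  have hmono : Monotone fun k : ℕ => Set.Icc (1 / ((k : ℝ) + 1)) ((k : ℝ) + 1) := by
    intro i j hij
    have : (i : ℝ) ≤ j := by exact_mod_cast hij
    refine Set.Icc_subset_Icc ?_ (by linarith)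
    gcongr
  have hU : ⋃ k : ℕ, Set.Icc (1 / ((k : ℝ) + 1)) ((k : ℝ) + 1) = Set.Ioi 0 := by
    ext R
    simp only [Set.mem_iUnion, Set.mem_Icc, Set.mem_Ioi]
    constructor
    · rintro ⟨k, h1, _⟩
      exact lt_of_lt_of_le (by positivity) h1
    · intro hR
      obtain ⟨k, hk⟩ := exists_nat_ge (max R (1 / R))
      have a1 := (le_max_left _ _).trans hk
      have a2 := (le_max_right _ _).trans hk
      refine ⟨k, ?_, by linarith⟩
      rw [div_le_iff₀ (by positivity)] at a2 ⊢
      nlinarith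
  have l4 := tendsto_measure_iUnion_atTop (μ := volume.withDensity h) hmono
  rw [hU, withDensity_apply _ measurableSet_Ioi] at l4
  have l5 : Tendsto (fun k : ℕ => ENNReal.ofReal (G (1 / ((k : ℝ) + 1)) - G ((k : ℝ) + 1))) atTop
      (𝓝 (∫⁻ R in Set.Ioi 0, h R)) := by
    refine l4.congr fun k => ?_
    simp only [comp_apply]
    rw [withDensity_apply _ measurableSet_Icc, hh2 _ _ (by positivity)]
    rw [div_le_iff₀ (by positivity)]
    have : (0 : ℝ) ≤ k := by positivity
    nlinarith
  rw [tendsto_nhds_unique l3 l5, hh, lintegral_lintegral_swap hfm.aemeasurable]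
  refine lintegral_congr fun W => ?_
  rw [Phi, ← lintegral_const_mul' _ _ ENNReal.ofReal_ne_top]
  refine lintegral_congr fun R => ?_
  have := S.nonneg W
  rw [← ENNReal.ofReal_mul (by positivity)]
  simp only [hf, tt]
  congr 1
  ring

end Sol

namespace Sol
variable {n p : ℕ} {b α : ℝ} {v : LS n → ℝ}

/-- the critical exponent -/
noncomputable def ka (n p : ℕ) (b : ℝ) : ℝ := (n : ℝ) + 2 + b - 2 * p

lemma ka_pos (S : Sol n p b α v) : 0 < ka n p b := by
  have := S.hN
  unfold ka; linarith

lemma repr1 (S : Sol n p b α v) (hne : ∃ W, v W ≠ 0) : ∃ C : ℝ, 0 < C ∧ ∀ Z : LS n, lq Z = 0 →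
    0 < v Z ∧ ENNReal.ofReal (v Z) = ENNReal.ofReal C * ∫⁻ W, ENNReal.ofReal (‖W - Z‖ ^ (-ka n p b)) *
      ENNReal.ofReal (v W ^ α) ∂(mw n b) := by
  have hα := S.hα
  have hka := S.ka_pos
  have hvm : Measurable v := S.cont.measurable
  obtain ⟨m, hm, hk⟩ := S.exists_m
  set c := ∫ W, (psi ((n : ℝ) + 2 + b) p m).eval (tt 0 1 W) ∂(mw n b) with hc
  have hP0 := Phi_ne_zero (-ka n p b) m
  have hPt := Phi_ne_top (e := -ka n p b) (by linarith) (m := m) (by omega)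
  set Φ := Phi (-ka n p b) m 1
  have h1 : ∀ Z : LS n, lq Z = 0 → ENNReal.ofReal (v Z * c) =
      Φ * ∫⁻ W, ENNReal.ofReal (‖W - Z‖ ^ (-ka n p b)) * ENNReal.ofReal (v W ^ α) ∂(mw n b) := by
    intro Z hZ
    rw [hc, S.repr0 hm hk hZ, ← lintegral_const_mul' _ _ hPt]
    refine lintegral_congr_ae ?_
    have : ∀ᵐ W ∂(mw n b), W ≠ Z := by
      rw [ae_iff]; simpa using mw_singleton n b Z
    filter_upwards [this] with W hW
    have he : 2 * (p : ℝ) - ((n : ℝ) + 2 + b) = -ka n p b := by unfold ka; ring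
    rw [he, Phi_scale _ _ (norm_pos_iff.2 (sub_ne_zero.2 hW))]
    ring
  have h2 : ∀ Z : LS n, lq Z = 0 → 0 < v Z * c := by
    intro Z hZ
    rw [← ENNReal.ofReal_pos, h1 Z hZ]
    refine ENNReal.mul_pos hP0 (ne_of_gt ?_)
    rw [lintegral_pos_iff_support (by fun_prop)]
    obtain ⟨W0, hW0⟩ := hne
    have hop : IsOpen {W : LS n | 0 < v W} := isOpen_lt continuous_const S.cont
    have hp1 := mw_open_pos n S.hb hop ⟨W0, lt_of_le_of_ne (S.nonneg W0) (Ne.symm hW0)⟩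
    have hp2 : 0 < mw n b ({W : LS n | 0 < v W} \ {Z}) := by
      rwa [measure_sdiff_null (mw_singleton n b Z)]
    refine hp2.trans_le (measure_mono ?_)
    rintro W ⟨hW : 0 < v W, hWZ⟩
    have h3 : 0 < ‖W - Z‖ := norm_pos_iff.2 (sub_ne_zero.2 hWZ)
    rw [mem_support]
    refine mul_ne_zero ?_ ?_ <;> rw [← pos_iff_ne_zero, ENNReal.ofReal_pos] <;> positivity
  have h0 := h2 0 (by simp [lq])
  have hcpos : 0 < c := by
    by_contra h
    push Not at h
    have := mul_nonpos_of_nonneg_of_nonpos (S.nonneg 0) h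
    linarith
  refine ⟨Φ.toReal / c, by have := ENNReal.toReal_pos hP0 hPt; positivity, fun Z hZ => ⟨?_, ?_⟩⟩
  · have := h2 Z hZ
    exact pos_of_mul_pos_left this hcpos.le
  · have h3 := h1 Z hZ
    rw [ENNReal.ofReal_div_of_pos hcpos, ENNReal.ofReal_toReal hPt, ENNReal.div_eq_inv_mul, mul_assoc, ← h3,
      ENNReal.ofReal_mul (S.nonneg Z), mul_comm (ENNReal.ofReal (v Z)), ← mul_assoc,
      ENNReal.inv_mul_cancel, one_mul]
    · simpa using hcpos
    · exact ENNReal.ofReal_ne_top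

lemma pos (S : Sol n p b α v) (hne : ∃ W, v W ≠ 0) (W : LS n) : 0 < v W := by
  obtain ⟨C, hC, h⟩ := S.repr1 hne
  obtain ⟨W', h1, h2, h3⟩ := S.sym W
  have := (h W' h1).1
  have h4 := h3 1
  simp only [one_smul] at h4
  rwa [← h4]

lemma min_ball (S : Sol n p b α v) (hne : ∃ W, v W ≠ 0) :
    ∃ c : ℝ, 0 < c ∧ ∀ W : LS n, ‖W‖ ≤ 1 → c ≤ v W := by
  obtain ⟨W0, _, h⟩ := (isCompact_closedBall (0 : LS n) 1).exists_isMinOn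
    ⟨0, by simp⟩ S.cont.continuousOn
  exact ⟨v W0, S.pos hne W0, fun W hW => h (by simpa using hW)⟩

lemma J_fin (S : Sol n p b α v) (hne : ∃ W, v W ≠ 0) :
    ∫⁻ W, (ball (0 : LS n) 1).indicator (fun W => ENNReal.ofReal (‖W‖ ^ (-ka n p b))) W ∂(mw n b) ≠ ⊤ := by
  have hα := S.hα
  obtain ⟨C, hC, h⟩ := S.repr1 hne
  obtain ⟨c, hc, hmin⟩ := S.min_ball hne
  have h0 := (h 0 (by simp [lq])).2
  simp only [sub_zero] at h0
  intro htop
  have h1 : ENNReal.ofReal (c ^ α) *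
      ∫⁻ W, (ball (0 : LS n) 1).indicator (fun W => ENNReal.ofReal (‖W‖ ^ (-ka n p b))) W ∂(mw n b) ≤
      ∫⁻ W, ENNReal.ofReal (‖W‖ ^ (-ka n p b)) * ENNReal.ofReal (v W ^ α) ∂(mw n b) := by
    rw [← lintegral_const_mul' _ _ ENNReal.ofReal_ne_top]
    refine lintegral_mono fun W => ?_
    by_cases hW : W ∈ ball (0 : LS n) 1
    · simp only [Set.indicator_of_mem hW]
      rw [mul_comm]
      gcongr
      exact hmin W ((mem_ball_zero_iff.1 hW).le)
    · simp [Set.indicator_of_notMem hW]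
  rw [htop, ENNReal.mul_top (by simpa using by positivity), top_le_iff] at h1
  rw [h1, ENNReal.mul_top (by simpa using hC)] at h0
  exact ENNReal.ofReal_ne_top h0

lemma unif (S : Sol n p b α v) (hne : ∃ W, v W ≠ 0) {η : ENNReal} (hη : η ≠ 0) :
    ∃ δ : ENNReal, 0 < δ ∧ ∀ s : Set (LS n), MeasurableSet s → mw n b s < δ → ∀ X : LS n, lq X = 0 →
      ∫⁻ W in s, ENNReal.ofReal (‖W - X‖ ^ (-ka n p b)) ∂(mw n b) ≤ η := by
  have hka := S.ka_pos
  obtain ⟨δ, hδ, h⟩ := exists_pos_setLIntegral_lt_of_measure_lt (S.J_fin hne)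
    (ENNReal.half_pos hη).ne'
  refine ⟨min δ (η / 2), lt_min hδ (ENNReal.half_pos hη), fun s hs hlt X hX => ?_⟩
  have hT := mw_translate S.hb hX
  have hs' : MeasurableSet ((fun W => W + X) ⁻¹' s) := hT.measurable hs
  have h1 : mw n b ((fun W => W + X) ⁻¹' s) = mw n b s := hT.measure_preimage hs.nullMeasurableSet
  have h2 := h _ (h1.trans_lt (hlt.trans_le (min_le_left _ _)))
  rw [← hT.setLIntegral_comp_preimage hs (by fun_prop)]
  simp only [add_sub_cancel_right]
  calc ∫⁻ W in (fun W => W + X) ⁻¹' s, ENNReal.ofReal (‖W‖ ^ (-ka n p b)) ∂(mw n b) ≤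
      ∫⁻ W in (fun W => W + X) ⁻¹' s, ((ball (0 : LS n) 1).indicator
        (fun W => ENNReal.ofReal (‖W‖ ^ (-ka n p b))) W + 1) ∂(mw n b) := by
        refine lintegral_mono fun W => ?_
        by_cases hW : W ∈ ball (0 : LS n) 1
        · simp [Set.indicator_of_mem hW]
        · simp only [Set.indicator_of_notMem hW, zero_add]
          simp only [mem_ball, dist_zero_right, not_lt] at hW
          rw [ENNReal.ofReal_le_one]
          exact Real.rpow_le_one_of_one_le_of_nonpos hW (by linarith)
    _ ≤ η / 2 + η / 2 := by
      rw [lintegral_add_right _ measurable_const]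
      refine add_le_add h2.le ?_
      simp only [lintegral_const, one_mul, Measure.restrict_apply MeasurableSet.univ, Set.univ_inter]
      rw [h1]
      exact (hlt.trans_le (min_le_right _ _)).le
    _ = η := ENNReal.add_halves η

end Sol

namespace Sol
variable {n p : ℕ} {b α : ℝ} {v : LS n → ℝ}

/-- Kelvin transform -/
noncomputable def vl (κ : ℝ) (v : LS n → ℝ) (l : ℝ) (W : LS n) : ℝ := (l / ‖W‖) ^ κ * v (kel l W)

/-- reflected kernel -/
noncomputable def K2 (κ : ℝ) (l : ℝ) (X W : LS n) : ℝ := (l / ‖X‖) ^ κ * ‖W - kel l X‖ ^ (-κ)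

/-- punctured ball -/
def pb (n : ℕ) (l : ℝ) : Set (LS n) := ball 0 l \ {0}

lemma pb_meas (l : ℝ) : MeasurableSet (pb n l) := measurableSet_ball.diff (measurableSet_singleton _)

lemma mem_pb {l : ℝ} {W : LS n} : W ∈ pb n l ↔ 0 < ‖W‖ ∧ ‖W‖ < l := by
  simp [pb, and_comm]

lemma kel_dist' {l : ℝ} (hl : 0 < l) {X W : LS n} (hX : 0 < ‖X‖) (hW : 0 < ‖W‖) :
    ‖kel l W - X‖ = (l / ‖W‖) / (l / ‖X‖) * ‖W - kel l X‖ := by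
  have hk : kel l X ≠ 0 := by
    rw [← norm_pos_iff, norm_kel]; positivity
  have := kel_dist (l := l) (norm_pos_iff.1 hW) hk
  rw [kel_kel hl.ne', norm_kel] at this
  rw [this]
  field_simp

lemma K2_lt {κ : ℝ} (hκ : 0 < κ) {l : ℝ} {X W : LS n} (hX : X ∈ pb n l) (hW : W ∈ pb n l)
    (hne : W ≠ X) : K2 κ l X W < ‖W - X‖ ^ (-κ) := by
  rw [mem_pb] at hX hW
  obtain ⟨hX0, hXl⟩ := hX
  obtain ⟨hW0, hWl⟩ := hW
  have hl : 0 < l := hX0.trans hXl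
  have hd : 0 < ‖W - X‖ := norm_pos_iff.2 (sub_ne_zero.2 hne)
  set s := l / ‖X‖ with hs
  have hs0 : 0 < s := by positivity
  have h1 : ‖W - kel l X‖ ^ 2 = ‖W‖ ^ 2 - 2 * s ^ 2 * inner ℝ W X + s ^ 4 * ‖X‖ ^ 2 := by
    rw [kel, norm_sub_sq_real, inner_smul_right, norm_smul, Real.norm_eq_abs, mul_pow, sq_abs, ← hs]
    ring
  have h2 : ‖W - X‖ ^ 2 = ‖W‖ ^ 2 - 2 * inner ℝ W X + ‖X‖ ^ 2 := norm_sub_sq_real W X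
  have h3 : (‖W - kel l X‖ / s) ^ 2 - ‖W - X‖ ^ 2 = (l ^ 2 - ‖X‖ ^ 2) * (l ^ 2 - ‖W‖ ^ 2) / l ^ 2 := by
    rw [div_pow, h1, h2, hs]
    field_simp
    ring
  have h4 : 0 < (l ^ 2 - ‖X‖ ^ 2) * (l ^ 2 - ‖W‖ ^ 2) / l ^ 2 := by
    have a1 : 0 < l ^ 2 - ‖X‖ ^ 2 := by nlinarith
    have a2 : 0 < l ^ 2 - ‖W‖ ^ 2 := by nlinarith
    positivity
  have h5 : ‖W - X‖ < ‖W - kel l X‖ / s :=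
    lt_of_pow_lt_pow_left₀ 2 (by positivity) (by linarith)
  have h6 : K2 κ l X W = (‖W - kel l X‖ / s) ^ (-κ) := by
    rw [K2, Real.div_rpow (norm_nonneg _) hs0.le, Real.rpow_neg hs0.le, div_inv_eq_mul, mul_comm]
  rw [h6]
  exact Real.rpow_lt_rpow_of_neg hd h5 (by linarith)

lemma ptA (κ N α : ℝ) {l : ℝ} (hl : 0 < l) (hv : ∀ W, 0 ≤ v W) {X W : LS n} (hX : 0 < ‖X‖) (hW : 0 < ‖W‖) :
    (l / ‖W‖) ^ (2 * N) * (‖kel l W - X‖ ^ (-κ) * v (kel l W) ^ α) =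
      K2 κ l X W * ((l / ‖W‖) ^ (2 * N - κ - α * κ) * vl κ v l W ^ α) := by
  unfold K2 vl
  rw [kel_dist' hl hX hW]
  have hr : 0 < l / ‖W‖ := by positivity
  have hs : 0 < l / ‖X‖ := by positivity
  set r := l / ‖W‖
  set s := l / ‖X‖
  have hvk := hv (kel l W)
  rw [Real.mul_rpow (by positivity) (by positivity), Real.mul_rpow (by positivity) hvk,
    Real.div_rpow hr.le hs.le, ← Real.rpow_mul hr.le, Real.rpow_neg hs.le κ, div_inv_eq_mul]
  have : r ^ (2 * N) = r ^ (2 * N - κ - α * κ) * r ^ κ * r ^ (κ * α) := by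
    rw [← Real.rpow_add hr, ← Real.rpow_add hr]; congr 1; ring
  rw [this, Real.rpow_neg hr.le]
  have h3 : r ^ κ ≠ 0 := by positivity
  field_simp

lemma ptB (κ N α : ℝ) {l : ℝ} (hl : 0 < l) (hv : ∀ W, 0 ≤ v W) {X W : LS n} (hX : 0 < ‖X‖) (hW : 0 < ‖W‖) :
    (l / ‖X‖) ^ κ * ((l / ‖W‖) ^ (2 * N) * (‖kel l W - kel l X‖ ^ (-κ) * v (kel l W) ^ α)) =
      ‖W - X‖ ^ (-κ) * ((l / ‖W‖) ^ (2 * N - κ - α * κ) * vl κ v l W ^ α) := by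
  unfold vl
  rw [kel_dist (norm_pos_iff.1 hW) (norm_pos_iff.1 hX)]
  have hr : 0 < l / ‖W‖ := by positivity
  have hs : 0 < l / ‖X‖ := by positivity
  have e : l ^ 2 / (‖W‖ * ‖X‖) = (l / ‖W‖) * (l / ‖X‖) := by field_simp
  rw [e]
  set r := l / ‖W‖
  set s := l / ‖X‖
  have hvk := hv (kel l W)
  rw [Real.mul_rpow (by positivity) (by positivity), Real.mul_rpow (by positivity) hvk,
    Real.mul_rpow hr.le hs.le, ← Real.rpow_mul hr.le, Real.rpow_neg hs.le κ]
  have : r ^ (2 * N) = r ^ (2 * N - κ - α * κ) * r ^ κ * r ^ (κ * α) := by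
    rw [← Real.rpow_add hr, ← Real.rpow_add hr]; congr 1; ring
  rw [this, Real.rpow_neg hr.le]
  have h3 : r ^ κ ≠ 0 := by positivity
  have h4 : s ^ κ ≠ 0 := by positivity
  field_simp

lemma split (S : Sol n p b α v) {l : ℝ} (hl : 0 < l) (g : LS n → ENNReal) :
    ∫⁻ W, g W ∂(mw n b) = ∫⁻ W in pb n l, g W ∂(mw n b) +
      ∫⁻ W in pb n l, ENNReal.ofReal ((l / ‖W‖) ^ (2 * ((n : ℝ) + 2 + b))) * g (kel l W) ∂(mw n b) := by
  rw [pb, ← mw_kel S.hb hl, ← lintegral_add_compl g (pb_meas l)]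
  congr 1
  refine setLIntegral_congr ?_
  have h0 : ∀ᵐ W ∂(mw n b), W ≠ 0 := by
    rw [ae_iff]; simpa using mw_singleton n b 0
  have h1 : ∀ᵐ W ∂(mw n b), W ∉ sphere (0 : LS n) l :=
    measure_eq_zero_iff_ae_notMem.1 (mw_sphere n b 0 l)
  filter_upwards [h0, h1] with W hW0 hW1
  rw [eq_iff_iff]
  show W ∉ pb n l ↔ l < ‖W‖
  have h2 : 0 < ‖W‖ := norm_pos_iff.2 hW0
  rw [mem_sphere_zero_iff_norm] at hW1
  rw [mem_pb]
  constructor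
  · intro h
    by_contra hc
    push Not at hc
    exact h ⟨h2, lt_of_le_of_ne hc hW1⟩
  · intro h hc
    linarith [hc.2]

lemma kel_meas (l : ℝ) : Measurable (kel (n := n) l) := by
  unfold kel; fun_prop

lemma vl_meas (S : Sol n p b α v) (κ l : ℝ) : Measurable (vl κ v l) := by
  have := S.cont.measurable
  have := kel_meas (n := n) l
  unfold vl; fun_prop

lemma vl_nonneg (S : Sol n p b α v) (κ : ℝ) {l : ℝ} (hl : 0 < l) (W : LS n) : 0 ≤ vl κ v l W := by
  have := S.nonneg (kel l W)
  unfold vl; positivity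

lemma K2_meas (κ l : ℝ) (X : LS n) : Measurable (K2 κ l X) := by
  unfold K2; fun_prop

lemma K2_nonneg (κ : ℝ) {l : ℝ} (hl : 0 < l) (X W : LS n) : 0 ≤ K2 κ l X W := by
  unfold K2; positivity

/-- weighted reflected nonlinearity -/
noncomputable def Ew (n p : ℕ) (b α : ℝ) (v : LS n → ℝ) (l : ℝ) (W : LS n) : ℝ :=
  (l / ‖W‖) ^ (2 * ((n : ℝ) + 2 + b) - ka n p b - α * ka n p b) * vl (ka n p b) v l W ^ α

lemma Ew_meas (S : Sol n p b α v) (l : ℝ) : Measurable (Ew n p b α v l) := by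
  have := S.vl_meas (ka n p b) l
  unfold Ew; fun_prop

lemma Ew_nonneg (S : Sol n p b α v) {l : ℝ} (hl : 0 < l) (W : LS n) : 0 ≤ Ew n p b α v l W := by
  have := S.vl_nonneg (ka n p b) hl W
  unfold Ew; positivity

lemma lq_kel0 {l : ℝ} {X : LS n} (hX : lq X = 0) : lq (kel l X) = 0 := by
  rw [lq_kel, hX, mul_zero]

lemma ident (S : Sol n p b α v) {C : ℝ} (hC : ∀ Z : LS n, lq Z = 0 →
    0 < v Z ∧ ENNReal.ofReal (v Z) = ENNReal.ofReal C * ∫⁻ W, ENNReal.ofReal (‖W - Z‖ ^ (-ka n p b)) *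
      ENNReal.ofReal (v W ^ α) ∂(mw n b)) {l : ℝ} (hl : 0 < l) {X : LS n} (hX : lq X = 0) (hX0 : 0 < ‖X‖) :
    ENNReal.ofReal (v X) = ENNReal.ofReal C * ∫⁻ W in pb n l, ENNReal.ofReal
      (‖W - X‖ ^ (-ka n p b) * v W ^ α + K2 (ka n p b) l X W * Ew n p b α v l W) ∂(mw n b) ∧
    ENNReal.ofReal (vl (ka n p b) v l X) = ENNReal.ofReal C * ∫⁻ W in pb n l, ENNReal.ofReal
      (K2 (ka n p b) l X W * v W ^ α + ‖W - X‖ ^ (-ka n p b) * Ew n p b α v l W) ∂(mw n b) := by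
  have hvm : Measurable v := S.cont.measurable
  have hEm := S.Ew_meas l
  have hKm := K2_meas (ka n p b) l X
  have hE0 := S.Ew_nonneg hl
  have hK0 := K2_nonneg (ka n p b) hl X
  have hA0 : ∀ W, 0 ≤ v W ^ α := fun W => Real.rpow_nonneg (S.nonneg W) _
  have hp0 : ∀ (W : LS n), 0 ≤ ‖W - X‖ ^ (-ka n p b) := fun W => by positivity
  constructor
  · rw [(hC X hX).2, S.split hl, ← lintegral_add_left (by fun_prop)]
    congr 1
    refine setLIntegral_congr_fun (pb_meas l) fun W hW => ?_
    have hW0 := (mem_pb.1 hW).1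
    rw [ENNReal.ofReal_add (mul_nonneg (hp0 W) (hA0 W)) (mul_nonneg (hK0 W) (hE0 W)),
      ENNReal.ofReal_mul (hp0 W)]
    congr 1
    rw [Ew, ← ptA _ _ _ hl S.nonneg hX0 hW0, ENNReal.ofReal_mul (by positivity),
      ENNReal.ofReal_mul (by positivity)]
  · rw [vl, ENNReal.ofReal_mul (by positivity), (hC _ (lq_kel0 hX)).2, S.split hl,
      ← lintegral_add_left (by fun_prop), mul_left_comm, ← lintegral_const_mul' _ _ ENNReal.ofReal_ne_top]
    congr 1
    refine setLIntegral_congr_fun (pb_meas l) fun W hW => ?_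
    have hW0 := (mem_pb.1 hW).1
    rw [ENNReal.ofReal_add (mul_nonneg (hK0 W) (hA0 W)) (mul_nonneg (hp0 W) (hE0 W)),
      ENNReal.ofReal_mul (hK0 W), mul_add]
    congr 1
    · rw [K2, ENNReal.ofReal_mul (by positivity), mul_assoc]
    · rw [Ew, ← ptB _ _ _ hl S.nonneg hX0 hW0, ENNReal.ofReal_mul (by positivity),
        ENNReal.ofReal_mul (by positivity), ENNReal.ofReal_mul (by positivity)]

end Sol

lemma rpow_diff {α M x y : ℝ} (hα : 1 < α) (hx : 0 ≤ x) (hxy : x ≤ y) (hy : y ≤ M) :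
    y ^ α - x ^ α ≤ α * M ^ (α - 1) * (y - x) := by
  rcases (hx.trans hxy).eq_or_lt with h | h
  · have hx0 : x = 0 := le_antisymm (by linarith) hx
    subst hx0; subst h; simp
  · have h1 := one_add_mul_self_le_rpow_one_add (s := x / y - 1) (p := α)
      (by have : 0 ≤ x / y := by positivity
          linarith) hα.le
    rw [add_sub_cancel, Real.div_rpow hx h.le, le_div_iff₀ (by positivity)] at h1
    have h2 : y ^ α = y ^ (α - 1) * y := by rw [← Real.rpow_add_one h.ne']; simp
    have h3 : (1 + α * (x / y - 1)) * y ^ α = y ^ α - α * y ^ (α - 1) * (y - x) := by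
      rw [h2]; field_simp; ring
    have h4 : y ^ (α - 1) ≤ M ^ (α - 1) := Real.rpow_le_rpow h.le hy (by linarith)
    have h5 : α * y ^ (α - 1) * (y - x) ≤ α * M ^ (α - 1) * (y - x) := by
      have : 0 ≤ y - x := by linarith
      gcongr
    linarith

namespace Sol
variable {n p : ℕ} {b α : ℝ} {v : LS n → ℝ}

/-- the representation formula as a proposition -/
def Rep (n p : ℕ) (b α : ℝ) (v : LS n → ℝ) (C : ℝ) : Prop := ∀ Z : LS n, lq Z = 0 →
    0 < v Z ∧ ENNReal.ofReal (v Z) = ENNReal.ofReal C * ∫⁻ W, ENNReal.ofReal (‖W - Z‖ ^ (-ka n p b)) *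
      ENNReal.ofReal (v W ^ α) ∂(mw n b)

/-- the bad set -/
def bad (n p : ℕ) (b : ℝ) (v : LS n → ℝ) (l : ℝ) : Set (LS n) :=
  pb n l ∩ {W | vl (ka n p b) v l W < v W}

lemma bad_meas (S : Sol n p b α v) (l : ℝ) : MeasurableSet (bad n p b v l) :=
  (pb_meas l).inter (measurableSet_lt (S.vl_meas _ l) S.cont.measurable)

lemma Ew_ge (S : Sol n p b α v) (hτ : α * ka n p b < (n : ℝ) + 2 + b + 2 * p) {l : ℝ} {W : LS n}
    (hW : W ∈ pb n l) : vl (ka n p b) v l W ^ α ≤ Ew n p b α v l W := by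
  rw [mem_pb] at hW
  have hl := hW.1.trans hW.2
  have h0 := S.vl_nonneg (ka n p b) hl W
  have h1 : 1 ≤ (l / ‖W‖) ^ (2 * ((n : ℝ) + 2 + b) - ka n p b - α * ka n p b) := by
    refine Real.one_le_rpow ?_ ?_
    · rw [one_le_div hW.1]; exact hW.2.le
    · have : ka n p b = (n : ℝ) + 2 + b - 2 * p := rfl
      linarith
  unfold Ew
  exact le_mul_of_one_le_left (by positivity) h1

lemma ae_ne (X : LS n) (s : Set (LS n)) : ∀ᵐ W ∂((mw n b).restrict s), W ≠ X := by
  refine ae_restrict_of_ae ?_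
  rw [ae_iff]; simpa using mw_singleton n b X

lemma step (S : Sol n p b α v) {C : ℝ} (hC0 : 0 < C) (hC : Rep n p b α v C)
    (hτ : α * ka n p b < (n : ℝ) + 2 + b + 2 * p) {l M D : ℝ} (hl : 0 < l)
    (hM : 0 < M) (hvM : ∀ W ∈ pb n l, v W ≤ M) (hD : 0 ≤ D)
    (hvD : ∀ W ∈ pb n l, v W - vl (ka n p b) v l W ≤ D) {η : ENNReal}
    (hη : ENNReal.ofReal (C * (α * M ^ (α - 1))) * η ≤ ENNReal.ofReal (1 / 2))
    (hs : ∀ X : LS n, lq X = 0 →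
      ∫⁻ W in bad n p b v l, ENNReal.ofReal (‖W - X‖ ^ (-ka n p b)) ∂(mw n b) ≤ η)
    {X : LS n} (hX : lq X = 0) (hXl : X ∈ pb n l) :
    v X - vl (ka n p b) v l X ≤ D / 2 := by
  have hα := S.hα
  have hvm : Measurable v := S.cont.measurable
  have hEm := S.Ew_meas l
  have hKm := K2_meas (ka n p b) l X
  have hX0 := (mem_pb.1 hXl).1
  obtain ⟨i1, i2⟩ := S.ident hC hl hX hX0
  have hbm := S.bad_meas l
  set κ := ka n p b with hκ
  have hκ0 : 0 < κ := S.ka_pos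
  set Q := α * M ^ (α - 1) * D with hQ
  have hQ0 : 0 ≤ Q := by positivity
  have key : ∫⁻ W in pb n l, ENNReal.ofReal
      (‖W - X‖ ^ (-κ) * v W ^ α + K2 κ l X W * Ew n p b α v l W) ∂(mw n b) ≤
      ∫⁻ W in pb n l, (ENNReal.ofReal
      (K2 κ l X W * v W ^ α + ‖W - X‖ ^ (-κ) * Ew n p b α v l W) +
        (bad n p b v l).indicator (fun W => ENNReal.ofReal Q * ENNReal.ofReal (‖W - X‖ ^ (-κ))) W) ∂(mw n b) := by
    refine lintegral_mono_ae ?_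
    filter_upwards [ae_ne X (pb n l), ae_restrict_mem (pb_meas l)] with W hWX hW
    have hlt := K2_lt hκ0 hXl hW hWX
    have hE := S.Ew_ge hτ hW
    have hK0 := K2_nonneg κ hl X W
    have hE0 := S.Ew_nonneg hl W
    have hv0 := S.nonneg W
    have hA0 : 0 ≤ v W ^ α := by positivity
    have hvl0 := S.vl_nonneg κ hl W
    have hK1 : 0 ≤ ‖W - X‖ ^ (-κ) := by positivity
    set k1 := ‖W - X‖ ^ (-κ)
    set k2 := K2 κ l X W
    set A := v W ^ α
    set E := Ew n p b α v l W
    by_cases hb : W ∈ bad n p b v l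
    · rw [Set.indicator_of_mem hb, ← ENNReal.ofReal_mul hQ0,
        ← ENNReal.ofReal_add (by positivity) (by positivity)]
      refine ENNReal.ofReal_le_ofReal ?_
      have h1 := rpow_diff hα hvl0 hb.2.le (hvM W hW)
      have h2 : α * M ^ (α - 1) * (v W - vl κ v l W) ≤ Q := by
        rw [hQ]; gcongr; exact hvD W hW
      have h3 : A - E ≤ Q := by linarith
      have h4 : (k1 - k2) * (A - E) ≤ (k1 - k2) * Q :=
        mul_le_mul_of_nonneg_left h3 (by linarith)
      nlinarith [mul_nonneg hK0 hQ0]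
    · rw [Set.indicator_of_notMem hb, add_zero]
      refine ENNReal.ofReal_le_ofReal ?_
      have h1 : v W ≤ vl κ v l W := by
        by_contra hc
        push Not at hc
        exact hb ⟨hW, hc⟩
      have h2 : A ≤ vl κ v l W ^ α := Real.rpow_le_rpow hv0 h1 (by linarith)
      have h4 : 0 ≤ (k1 - k2) * (E - A) := mul_nonneg (by linarith) (by linarith)
      nlinarith
  rw [lintegral_add_left (by fun_prop), setLIntegral_indicator hbm,
    lintegral_const_mul' _ _ ENNReal.ofReal_ne_top] at key
  have h5 : ENNReal.ofReal (v X) ≤ ENNReal.ofReal (vl κ v l X) + ENNReal.ofReal (D / 2) := by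
    rw [i1, i2]
    refine (mul_le_mul_right key _).trans ?_
    rw [mul_add]
    refine add_le_add le_rfl ?_
    calc ENNReal.ofReal C * (ENNReal.ofReal Q * ∫⁻ W in bad n p b v l ∩ pb n l,
          ENNReal.ofReal (‖W - X‖ ^ (-κ)) ∂(mw n b)) ≤
        ENNReal.ofReal C * (ENNReal.ofReal Q * η) := by
          gcongr
          exact (lintegral_mono_set Set.inter_subset_left).trans (hs X hX)
      _ = ENNReal.ofReal D * (ENNReal.ofReal (C * (α * M ^ (α - 1))) * η) := by
          rw [hQ, ENNReal.ofReal_mul hC0.le, ENNReal.ofReal_mul (p := α * M ^ (α - 1)) (by positivity)]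
          ring
      _ ≤ ENNReal.ofReal D * ENNReal.ofReal (1 / 2) := by gcongr
      _ = ENNReal.ofReal (D / 2) := by rw [← ENNReal.ofReal_mul hD]; congr 1; ring
  have hvl0 := S.vl_nonneg κ hl X
  rw [← ENNReal.ofReal_add hvl0 (by positivity), ENNReal.ofReal_le_ofReal_iff (by positivity)] at h5
  linarith

lemma vl_sym {W W' : LS n} (h : ‖W'‖ = ‖W‖) (h2 : ∀ c : ℝ, v (c • W') = v (c • W)) (κ l : ℝ) :
    v W' = v W ∧ vl κ v l W' = vl κ v l W := by
  refine ⟨by simpa using h2 1, ?_⟩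
  unfold vl kel
  rw [h, h2]

lemma good_of_small (S : Sol n p b α v) {C : ℝ} (hC0 : 0 < C) (hC : Rep n p b α v C)
    (hτ : α * ka n p b < (n : ℝ) + 2 + b + 2 * p) {l M : ℝ} (hl : 0 < l)
    (hM : 0 < M) (hvM : ∀ W ∈ pb n l, v W ≤ M) {η : ENNReal}
    (hη : ENNReal.ofReal (C * (α * M ^ (α - 1))) * η ≤ ENNReal.ofReal (1 / 2))
    (hs : ∀ X : LS n, lq X = 0 →
      ∫⁻ W in bad n p b v l, ENNReal.ofReal (‖W - X‖ ^ (-ka n p b)) ∂(mw n b) ≤ η) :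
    ∀ W ∈ pb n l, v W ≤ vl (ka n p b) v l W := by
  have h1 : ∀ k : ℕ, ∀ W ∈ pb n l, v W - vl (ka n p b) v l W ≤ M * (1 / 2) ^ k := by
    intro k
    induction k with
    | zero =>
      intro W hW
      have := hvM W hW
      have := S.vl_nonneg (ka n p b) hl W
      simp; linarith
    | succ k ih =>
      intro W hW
      obtain ⟨W', a1, a2, a3⟩ := S.sym W
      obtain ⟨b1, b2⟩ := vl_sym a2 a3 (ka n p b) l
      rw [← b1, ← b2]
      have := S.step hC0 hC hτ hl hM hvM (by positivity) ih hη hs a1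
        (by rw [mem_pb, a2, ← mem_pb]; exact hW)
      refine this.trans (le_of_eq ?_)
      rw [pow_succ]; ring
  intro W hW
  have h2 : Tendsto (fun k : ℕ => M * (1 / 2 : ℝ) ^ k) atTop (𝓝 0) := by
    simpa using (tendsto_pow_atTop_nhds_zero_of_lt_one (r := (1 / 2 : ℝ)) (by norm_num)
      (by norm_num)).const_mul M
  have := ge_of_tendsto' h2 fun k => h1 k W hW
  linarith

lemma strict (S : Sol n p b α v) {C : ℝ} (hC0 : 0 < C) (hC : Rep n p b α v C)
    (hτ : α * ka n p b < (n : ℝ) + 2 + b + 2 * p) (hpos : ∀ W, 0 < v W) {l : ℝ} (hl : 0 < l)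
    (hg : ∀ W ∈ pb n l, v W ≤ vl (ka n p b) v l W) :
    ∀ W ∈ pb n l, v W < vl (ka n p b) v l W := by
  have hα := S.hα
  have hvm : Measurable v := S.cont.measurable
  have hEm := S.Ew_meas l
  intro W hW
  obtain ⟨X, a1, a2, a3⟩ := S.sym W
  obtain ⟨b1, b2⟩ := vl_sym a2 a3 (ka n p b) l
  rw [← b1, ← b2]
  have hXl : X ∈ pb n l := by rw [mem_pb, a2, ← mem_pb]; exact hW
  have hX0 := (mem_pb.1 hXl).1
  have hKm := K2_meas (ka n p b) l X
  obtain ⟨i1, i2⟩ := S.ident hC hl a1 hX0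
  set κ := ka n p b with hκ
  have hκ0 : 0 < κ := S.ka_pos
  have hvl0 := S.vl_nonneg κ hl X
  have hCE : ENNReal.ofReal C ≠ 0 := by simpa using hC0
  have hvlpos : 0 < vl κ v l X := (hpos X).trans_le (hg X hXl)
  rw [← ENNReal.ofReal_lt_ofReal_iff hvlpos, i1, i2]
  refine ENNReal.mul_lt_mul_right hCE ENNReal.ofReal_ne_top ?_
  have hfin : ∫⁻ W in pb n l, ENNReal.ofReal
      (‖W - X‖ ^ (-κ) * v W ^ α + K2 κ l X W * Ew n p b α v l W) ∂(mw n b) ≠ ⊤ := by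
    intro h
    rw [h, ENNReal.mul_top hCE] at i1
    exact ENNReal.ofReal_ne_top i1
  have hμ : (mw n b).restrict (pb n l) ≠ 0 := by
    rw [Ne, Measure.restrict_eq_zero, pb, measure_sdiff_null (mw_singleton n b 0)]
    exact (mw_open_pos n S.hb isOpen_ball ⟨0, by simpa using hl⟩).ne'
  refine lintegral_strict_mono hμ (by fun_prop) hfin ?_
  filter_upwards [ae_ne X (pb n l), ae_restrict_mem (pb_meas l)] with W hWX hW
  have hlt := K2_lt hκ0 hXl hW hWX
  have hK0 := K2_nonneg κ hl X W
  have hv0 := hpos W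
  have hE : v W ^ α < Ew n p b α v l W := by
    have hW' := mem_pb.1 hW
    have h1 : v W ^ α ≤ vl κ v l W ^ α := Real.rpow_le_rpow hv0.le (hg W hW) (by linarith)
    have h2 : 1 < (l / ‖W‖) ^ (2 * ((n : ℝ) + 2 + b) - ka n p b - α * ka n p b) := by
      refine Real.one_lt_rpow ?_ ?_
      · rw [one_lt_div hW'.1]; exact hW'.2
      · have : ka n p b = (n : ℝ) + 2 + b - 2 * p := rfl
        linarith
    have h3 : 0 < v W ^ α := by positivity
    unfold Ew
    nlinarith
  have h3 : 0 < v W ^ α := by positivity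
  have hK1 : 0 < ‖W - X‖ ^ (-κ) := hK0.trans_lt hlt
  rw [ENNReal.ofReal_lt_ofReal_iff (by nlinarith [mul_pos hK1 (h3.trans hE), mul_nonneg hK0 h3.le])]
  nlinarith [mul_pos (sub_pos.2 hlt) (sub_pos.2 hE)]

end Sol

namespace Sol
variable {n p : ℕ} {b α : ℝ} {v : LS n → ℝ}

lemma vl_cont_l (S : Sol n p b α v) {κ : ℝ} (hκ : 0 < κ) (W : LS n) :
    Continuous fun l => vl κ v l W := by
  unfold vl kel
  have h1 : Continuous fun l : ℝ => (l / ‖W‖) ^ κ :=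
    (continuous_id.div_const _).rpow_const (fun _ => Or.inr hκ.le)
  have h2 : Continuous fun l : ℝ => (l / ‖W‖) ^ 2 • W := by fun_prop
  exact h1.mul (S.cont.comp h2)

lemma bad_tendsto (S : Sol n p b α v) {l : ℝ}
    (hg : ∀ W ∈ pb n l, v W < vl (ka n p b) v l W) :
    Tendsto (fun k => mw n b (bad n p b v k)) (𝓝[>] l) (𝓝 0) := by
  have hB : ∀ᶠ k in 𝓝[>] l, k < l + 1 :=
    mem_nhdsWithin_of_mem_nhds (Iio_mem_nhds (by linarith))
  have := tendsto_measure_of_ae_tendsto_indicator (μ := mw n b) (A := ∅)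
    (As := fun k => bad n p b v k) (B := ball 0 (l + 1)) (𝓝[>] l) MeasurableSet.empty
    (fun k => S.bad_meas k) measurableSet_ball (mw_ball_lt_top n S.hb 0 (l + 1)).ne ?_ ?_
  · simpa using this
  · filter_upwards [hB] with k hk W hW
    have := (mem_pb.1 hW.1).2
    simp; linarith
  · have h0 : ∀ᵐ W ∂(mw n b), W ≠ 0 := by
      rw [ae_iff]; simpa using mw_singleton n b 0
    have h1 : ∀ᵐ W ∂(mw n b), W ∉ sphere (0 : LS n) l := by
      exact measure_eq_zero_iff_ae_notMem.1 (mw_sphere n b 0 l)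
    filter_upwards [h0, h1] with W hW0 hW1
    simp only [mem_sphere, dist_zero_right] at hW1
    simp only [Set.mem_empty_iff_false, iff_false]
    have hW : 0 < ‖W‖ := norm_pos_iff.2 hW0
    rcases lt_or_gt_of_ne hW1 with h | h
    · have h2 := hg W (mem_pb.2 ⟨hW, h⟩)
      have h3 := (S.vl_cont_l S.ka_pos W).tendsto l
      filter_upwards [mem_nhdsWithin_of_mem_nhds (h3.eventually_const_lt h2)] with k hk hk2
      exact lt_asymm hk hk2.2
    · filter_upwards [mem_nhdsWithin_of_mem_nhds (Iio_mem_nhds h)] with k hk hk2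
      exact lt_asymm hk (mem_pb.1 hk2.1).2

lemma small_ball (S : Sol n p b α v) {δ : ENNReal} (hδ : 0 < δ) :
    ∃ r : ℝ, 0 < r ∧ ∀ l, 0 < l → l ≤ r → mw n b (ball 0 l) < δ := by
  have hN : (0 : ℝ) < n + 2 + b := by have := S.hb; positivity
  have h1 : Tendsto (fun l : ℝ => ENNReal.ofReal (l ^ ((n : ℝ) + 2 + b) * (mw n b).real (ball 0 1)))
      (𝓝 0) (𝓝 0) := by
    have h2 : Continuous fun l : ℝ =>
        ENNReal.ofReal (l ^ ((n : ℝ) + 2 + b) * (mw n b).real (ball 0 1)) :=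
      ENNReal.continuous_ofReal.comp
        ((continuous_id.rpow_const (fun _ => Or.inr hN.le)).mul continuous_const)
    have h3 := h2.tendsto 0
    simpa [Real.zero_rpow hN.ne'] using h3
  obtain ⟨r, hr, h⟩ := Metric.eventually_nhds_iff.1 (h1.eventually_lt_const hδ)
  refine ⟨r / 2, by positivity, fun l hl hlr => ?_⟩
  have h4 := h (y := l) (by rw [dist_zero_right, Real.norm_eq_abs, abs_of_pos hl]; linarith)
  rw [← mw_ball S.hb (Z := 0) (by simp [lq]) hl] at h4
  rwa [Measure.real, ENNReal.ofReal_toReal (mw_ball_lt_top n S.hb 0 l).ne] at h4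

lemma all_good (S : Sol n p b α v) (hne : ∃ W, v W ≠ 0)
    (hτ : α * ka n p b < (n : ℝ) + 2 + b + 2 * p) {L : ℝ} (hL : 0 < L) :
    ∀ W ∈ pb n L, v W ≤ vl (ka n p b) v L W := by
  have hα := S.hα
  have hka := S.ka_pos
  obtain ⟨C, hC0, hC⟩ := S.repr1 hne
  obtain ⟨M, hM⟩ := (isCompact_closedBall (0 : LS n) L).exists_bound_of_continuousOn
    S.cont.continuousOn
  have hM0 : 0 < |M| + 1 := by positivity
  have hvM : ∀ l ≤ L, ∀ W ∈ pb n l, v W ≤ |M| + 1 := by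
    intro l hl W hW
    have h1 := hM W (by have := (mem_pb.1 hW).2; simp; linarith)
    have := le_abs_self (v W)
    have := le_abs_self M
    rw [Real.norm_eq_abs] at h1
    linarith
  generalize |M| + 1 = M at hM0 hvM
  have hq : 0 < C * (α * M ^ (α - 1)) := by positivity
  set η : ENNReal := ENNReal.ofReal (1 / 2 / (C * (α * M ^ (α - 1)))) with hη
  have hη0 : η ≠ 0 := by
    rw [hη, Ne, ENNReal.ofReal_eq_zero, not_le]; positivity
  have hη1 : ENNReal.ofReal (C * (α * M ^ (α - 1))) * η ≤ ENNReal.ofReal (1 / 2) := by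
    rw [hη, ← ENNReal.ofReal_mul hq.le, mul_div_cancel₀ _ hq.ne']
  obtain ⟨δ, hδ, hδ2⟩ := S.unif hne hη0
  have key : ∀ l, 0 < l → l ≤ L → mw n b (bad n p b v l) < δ →
      ∀ W ∈ pb n l, v W ≤ vl (ka n p b) v l W := fun l hl hlL hb =>
    S.good_of_small hC0 hC hτ hl hM0 (hvM l hlL) hη1 (hδ2 _ (S.bad_meas l) hb)
  obtain ⟨r, hr, hr2⟩ := S.small_ball hδ
  have hsub : ∀ l, bad n p b v l ⊆ ball 0 l := fun l W hW => hW.1.1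
  set l1 := min r L with hl1
  have hl10 : 0 < l1 := lt_min hr hL
  have hl1L : l1 ≤ L := min_le_right _ _
  set G : Set ℝ := {l | ∀ W ∈ pb n l, v W ≤ vl (ka n p b) v l W} with hG
  have hcl : IsClosed G := by
    refine IsSeqClosed.isClosed ?_
    intro x l hx hxl W hW
    have hW2 := mem_pb.1 hW
    have h1 := ((S.vl_cont_l hka W).tendsto l).comp hxl
    refine ge_of_tendsto h1 ?_
    filter_upwards [hxl.eventually_const_lt hW2.2] with k hk
    exact hx k W (mem_pb.2 ⟨hW2.1, hk⟩)
  have hfin : Set.Icc l1 L ⊆ G := by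
    refine (hcl.inter isClosed_Icc).Icc_subset_of_forall_mem_nhdsWithin ?_ ?_
    · exact key l1 hl10 hl1L ((measure_mono (hsub l1)).trans_lt (hr2 l1 hl10 (min_le_left _ _)))
    · rintro l ⟨hlG, hl⟩
      have hl0 : 0 < l := hl10.trans_le hl.1
      have hs := S.strict hC0 hC hτ (S.pos hne) hl0 hlG
      have ht := S.bad_tendsto hs
      filter_upwards [ht.eventually_lt_const hδ, self_mem_nhdsWithin,
        mem_nhdsWithin_of_mem_nhds (Iio_mem_nhds hl.2)] with k hk hk2 hk3
      exact key k (hl0.trans hk2) (le_of_lt hk3) hk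
  exact hfin ⟨hl1L, le_rfl⟩

lemma lower (S : Sol n p b α v) (hne : ∃ W, v W ≠ 0)
    (hτ : α * ka n p b < (n : ℝ) + 2 + b + 2 * p) :
    ∃ c : ℝ, 0 < c ∧ ∀ R : ℝ, 1 ≤ R → ∀ Y : LS n, ‖Y‖ ≤ R → c * R ^ (-(ka n p b / 2)) ≤ v Y := by
  have hka := S.ka_pos
  obtain ⟨c, hc, h⟩ := S.min_ball hne
  refine ⟨c, hc, fun R hR Y hY => ?_⟩
  have hR0 : 0 < R := by linarith
  rcases le_or_gt ‖Y‖ 1 with h1 | h1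
  · refine le_trans ?_ (h Y h1)
    have : R ^ (-(ka n p b / 2)) ≤ 1 := Real.rpow_le_one_of_one_le_of_nonpos hR (by linarith)
    exact mul_le_of_le_one_right hc.le this
  · set l := √‖Y‖ with hl
    have hl1 : 1 < l := by rw [hl]; exact Real.lt_sqrt_of_sq_lt (by simpa using h1)
    have hl2 : l ^ 2 = ‖Y‖ := Real.sq_sqrt (norm_nonneg _)
    have hl0 : 0 < l := by linarith
    have hY0 : 0 < ‖Y‖ := by linarith
    have hW : ‖kel l Y‖ = 1 := by rw [norm_kel, hl2]; exact div_self hY0.ne'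
    have h2 := S.all_good hne hτ hl0 (kel l Y) (mem_pb.2 (by rw [hW]; exact ⟨one_pos, hl1⟩))
    unfold vl at h2
    rw [kel_kel hl0.ne', hW, div_one] at h2
    have h3 := (h (kel l Y) hW.le).trans h2
    have h4 : l ^ ka n p b = ‖Y‖ ^ (ka n p b / 2) := by
      rw [← hl2, ← Real.rpow_natCast l 2, ← Real.rpow_mul hl0.le]
      congr 1; push_cast; ring
    have h5 : ‖Y‖ ^ (ka n p b / 2) ≤ R ^ (ka n p b / 2) :=
      Real.rpow_le_rpow hY0.le hY (by positivity)
    rw [Real.rpow_neg hR0.le, ← div_eq_mul_inv, div_le_iff₀ (by positivity), mul_comm]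
    rw [h4] at h3
    exact h3.trans (mul_le_mul_of_nonneg_right h5 (S.nonneg Y))

theorem eq_zero (S : Sol n p b α v) (hτ : α * ka n p b < (n : ℝ) + 2 + b + 2 * p) (W : LS n) :
    v W = 0 := by
  by_contra hW
  have hne : ∃ W, v W ≠ 0 := ⟨W, hW⟩
  have hα := S.hα
  have hka := S.ka_pos
  obtain ⟨c, hc, hlow⟩ := S.lower hne hτ
  obtain ⟨m, hm, hk⟩ := S.exists_m
  obtain ⟨K, hK, hup⟩ := S.apriori hm hk
  set B := (mw n b).real (ball (0 : LS n) 1) with hB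
  have hB0 : 0 < B := by
    rw [hB, Measure.real, ENNReal.toReal_pos_iff]
    exact ⟨mw_open_pos n S.hb isOpen_ball ⟨0, by simp⟩, mw_ball_lt_top n S.hb 0 1⟩
  set N : ℝ := (n : ℝ) + 2 + b with hN
  have hlq : lq (0 : LS n) = 0 := by simp [lq]
  have main : ∀ R : ℝ, 1 ≤ R →
      (c ^ α * (3 / 4) ^ m * (1 / 2) ^ N * B) ≤
        K * R ^ (-(2 * p + 2 * p / (α - 1) - α * ka n p b / 2)) := by
    intro R hR
    have hR0 : 0 < R := by linarith
    have h1 := hup 0 hlq R hR0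
    set q : ℝ := (c * R ^ (-(ka n p b / 2))) ^ α * (3 / 4) ^ m with hq
    have h2 : q * (mw n b).real (ball (0 : LS n) (R / 2)) ≤
        ∫ W, v W ^ α * tt 0 R W ^ m ∂(mw n b) := by
      have e : q * (mw n b).real (ball (0 : LS n) (R / 2)) =
          ∫ W, (ball (0 : LS n) (R / 2)).indicator (fun _ => q) W ∂(mw n b) := by
        rw [integral_indicator measurableSet_ball]; simp [mul_comm]
      rw [e]
      refine integral_mono ?_ (S.int_pow 0 hR0 (by omega)) ?_
      · exact (integrable_indicator_iff measurableSet_ball).2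
          (integrableOn_const (mw_ball_lt_top n S.hb _ _).ne)
      · intro W
        have hv := S.nonneg W
        have ht := tt_nonneg 0 R W
        by_cases hW : W ∈ ball (0 : LS n) (R / 2)
        · simp only [Set.indicator_of_mem hW]
          rw [mem_ball, dist_zero_right] at hW
          have h3 := hlow R hR W (by linarith)
          have h4 : 3 / 4 ≤ tt 0 R W := by
            refine le_max_of_le_left ?_
            rw [sub_zero]
            have : ‖W‖ ^ 2 / R ^ 2 ≤ 1 / 4 := by
              rw [div_le_iff₀ (by positivity)]
              nlinarith [norm_nonneg W]
            linarith
          have h5 : (c * R ^ (-(ka n p b / 2))) ^ α ≤ v W ^ α :=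
            Real.rpow_le_rpow (by positivity) h3 (by linarith)
          rw [hq]
          gcongr
        · simp only [Set.indicator_of_notMem hW]
          positivity
    have h3 := h2.trans h1
    rw [mw_ball S.hb hlq (by positivity), ← hB, hq, Real.mul_rpow hc.le (by positivity),
      ← Real.rpow_mul hR0.le, div_eq_mul_one_div R 2, Real.mul_rpow hR0.le (by norm_num)] at h3
    have e1 : R ^ (-(2 * p + 2 * p / (α - 1) - α * ka n p b / 2)) =
        R ^ (N - 2 * p - 2 * p / (α - 1)) * R ^ (-(-(ka n p b / 2) * α + N)) := by
      rw [← Real.rpow_add hR0]; congr 1; ring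
    have e2 : R ^ (-(ka n p b / 2) * α) * R ^ N * R ^ (-(-(ka n p b / 2) * α + N)) = 1 := by
      rw [← Real.rpow_add hR0, ← Real.rpow_add hR0]; simp
    rw [e1]
    have h4 := mul_le_mul_of_nonneg_right h3
      (by positivity : 0 ≤ R ^ (-(-(ka n p b / 2) * α + N)))
    calc c ^ α * (3 / 4) ^ m * (1 / 2) ^ N * B
        = c ^ α * (3 / 4) ^ m * (1 / 2) ^ N * B *
          (R ^ (-(ka n p b / 2) * α) * R ^ N * R ^ (-(-(ka n p b / 2) * α + N))) := by
            rw [e2, mul_one]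
      _ ≤ _ := by
            refine le_trans (le_of_eq ?_) (h4.trans (le_of_eq ?_)) <;> ring
  have hexp : 0 < 2 * p + 2 * p / (α - 1) - α * ka n p b / 2 := by
    have h1 : 0 < α - 1 := by linarith
    have h2 : ka n p b = N - 2 * p := rfl
    have h3 : ka n p b * (α - 1) < 4 * p := by linarith
    have h4 : 2 * p + 2 * p / (α - 1) - α * ka n p b / 2 =
        α / (2 * (α - 1)) * (4 * p - ka n p b * (α - 1)) := by
      field_simp; ring
    rw [h4]
    have : 0 < 4 * p - ka n p b * (α - 1) := by linarith
    positivity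
  have t := (tendsto_rpow_neg_atTop hexp).const_mul K
  rw [mul_zero] at t
  have := ge_of_tendsto t (by
    filter_upwards [eventually_ge_atTop (1 : ℝ)] with R hR using main R hR)
  have h0 : 0 < c ^ α * (3 / 4) ^ m * (1 / 2) ^ N * B := by positivity
  linarith

end Sol

lemma sol_of {n p : ℕ} (hp : 1 ≤ p) {a : ℝ} (ha : 1 ≤ a)
    (hpa : 2 * (p : ℝ) < n + 2 * a) {α : ℝ} (hα1 : 1 < α)
    {u : EuclideanSpace ℝ (Fin n) × ℝ → ℝ}
    (hreg : ContDiffOn ℝ (2 * p) u {z : EuclideanSpace ℝ (Fin n) × ℝ | 0 ≤ z.2})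
    (hnonneg : ∀ z : EuclideanSpace ℝ (Fin n) × ℝ, 0 ≤ z.2 → 0 ≤ u z)
    (heq : ∀ z : EuclideanSpace ℝ (Fin n) × ℝ, 0 < z.2 → negAIter n a p u z = u z ^ α) :
    Sol n p (2 * a - 2) α (fun W => u (tau W)) where
  hb := by linarith
  hp := hp
  hα := hα1
  hN := by linarith
  cont := lift_cont hreg
  nonneg W := hnonneg _ (tau_mem W)
  test Z hZ R hR P hP := test_identity ha hreg heq hZ hR P hP
  sym W := by
    refine ⟨WithLp.toLp 2 (Sum.elim (fun i => W (Sum.inl i))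
      ![√(W (Sum.inr 0) ^ 2 + W (Sum.inr 1) ^ 2), 0]), by simp [lq], ?_, fun c => ?_⟩
    · have h : 0 ≤ W (Sum.inr 0) ^ 2 + W (Sum.inr 1) ^ 2 := by positivity
      simp [EuclideanSpace.norm_eq, Fin.sum_univ_two, Real.sq_sqrt h]
    · have h : 0 ≤ W (Sum.inr 0) ^ 2 + W (Sum.inr 1) ^ 2 := by positivity
      congr 1
      simp only [tau]
      congr 1
      simp [mul_pow, Real.sq_sqrt h]
      ring

theorem fin_thm (n p : ℕ) (hn : 1 ≤ n) (hp : 1 ≤ p) (a : ℝ) (ha : 1 ≤ a)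
    (hpa : 2 * (p : ℝ) < n + 2 * a) (α : ℝ) (hα1 : 1 < α)
    (hα2 : α < ((n : ℝ) + 2 * a + 2 * p) / ((n : ℝ) + 2 * a - 2 * p))
    (u : EuclideanSpace ℝ (Fin n) × ℝ → ℝ)
    (hreg : ContDiffOn ℝ (2 * p) u {z : EuclideanSpace ℝ (Fin n) × ℝ | 0 ≤ z.2})
    (hnonneg : ∀ z : EuclideanSpace ℝ (Fin n) × ℝ, 0 ≤ z.2 → 0 ≤ u z)
    (heq : ∀ z : EuclideanSpace ℝ (Fin n) × ℝ, 0 < z.2 → negAIter n a p u z = u z ^ α) :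
    ∀ z : EuclideanSpace ℝ (Fin n) × ℝ, 0 ≤ z.2 → u z = 0 := by
  intro z hz
  have S := sol_of hp ha hpa hα1 hreg hnonneg heq
  rw [lt_div_iff₀ (by linarith)] at hα2
  have h := S.eq_zero (by
    have : Sol.ka n p (2 * a - 2) = n + 2 * a - 2 * p := by unfold Sol.ka; ring
    rw [this]; linarith)
    (WithLp.toLp 2 (Sum.elim (fun i => z.1 i) ![2 * √z.2, 0]))
  have e : tau (n := n) (WithLp.toLp 2 (Sum.elim (fun i => z.1 i) ![2 * √z.2, 0])) = z := by
    ext i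
    · simp [tau]
    · simp [tau, mul_pow, Real.sq_sqrt hz]
      ring
  simpa only [e] using h

theorem stmt_0 (n p : ℕ) (hn : 1 ≤ n) (hp : 1 ≤ p) (a : ℝ) (ha : 1 ≤ a)
    (hpa : 2 * (p : ℝ) < n + 2 * a) (α : ℝ) (hα1 : 1 < α)
    (hα2 : α < ((n : ℝ) + 2 * a + 2 * p) / ((n : ℝ) + 2 * a - 2 * p))
    (u : EuclideanSpace ℝ (Fin n) × ℝ → ℝ)
    (hreg : ContDiffOn ℝ (2 * p) u {z : EuclideanSpace ℝ (Fin n) × ℝ | 0 ≤ z.2})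
    (hnonneg : ∀ z : EuclideanSpace ℝ (Fin n) × ℝ, 0 ≤ z.2 → 0 ≤ u z)
    (heq : ∀ z : EuclideanSpace ℝ (Fin n) × ℝ, 0 < z.2 → negAIter n a p u z = u z ^ α) :
    ∀ z : EuclideanSpace ℝ (Fin n) × ℝ, 0 ≤ z.2 → u z = 0 := by
  exact fin_thm n p hn hp a ha hpa α hα1 hα2 u hreg hnonneg heq
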